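/- arXiv:2509.19095 — 2 statements merged into one kernel-verified Lean document; each statement's English description precedes it below -/
import Mathlib

section
/- With the algorithm setup (n = dℓ, k = dr + c, c ∈ {−1,0,1}): the output collection D = L_1 ∪ … ∪ L_{ℓ−r+1} has exactly k(dℓ − k) + 1 elements. -/
open Finset

/-- `x +_n t`: add `t` to `x ∈ [n] = {1,…,n}` modulo `n`, with representative in `[n]`. -/
def shiftMod (n t x : ℕ) : ℕ := (x + t - 1) % n + 1

/-- `S +_n t`: add `t` to every element of `S ⊆ [n]` modulo `n`. -/
def shiftSet (n t : ℕ) (S : Finset ℕ) : Finset ℕ := S.image (shiftMod n t)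

/-- `x +_n t` for an integer shift `t`. -/
def shiftModZ (n : ℕ) (t : ℤ) (x : ℕ) : ℕ := ((((x : ℤ) + t - 1) % (n : ℤ)) + 1).toNat

/-- `S +_n t` for an integer shift `t`. -/
def shiftSetZ (n : ℕ) (t : ℤ) (S : Finset ℕ) : Finset ℕ := S.image (shiftModZ n t)

/-- Two sets `S`, `T` are weakly separated if there are no `a < b < c < d` with
`a, c ∈ S \ T` and `b, d ∈ T \ S`, nor with the roles of `S` and `T` exchanged. -/
def WeaklySeparated (S T : Finset ℕ) : Prop :=
  ¬ ∃ a b c d : ℕ, a < b ∧ b < c ∧ c < d ∧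
    ((a ∈ S \ T ∧ c ∈ S \ T ∧ b ∈ T \ S ∧ d ∈ T \ S) ∨
     (a ∈ T \ S ∧ c ∈ T \ S ∧ b ∈ S \ T ∧ d ∈ S \ T))

/-- The cyclic successor of `x` in a finite set `P ⊆ ℕ`: the least element of `P`
greater than `x` if one exists, and otherwise the least element of `P`. -/
def cyclicSucc (P : Finset ℕ) (x : ℕ) : ℕ :=
  if h : (P.filter (fun y => x < y)).Nonempty then (P.filter (fun y => x < y)).min' h
  else if h2 : P.Nonempty then P.min' h2 else 0

open scoped Classical in
/-- The cyclic interval of `P` from `u` to `v`: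
`{u, S_P(u), …, S_P^m(u)}` where `m ≥ 0` is minimal with `S_P^m(u) = v`. -/
noncomputable def cyclicIntervalTo (P : Finset ℕ) (u v : ℕ) : Finset ℕ :=
  if h : ∃ m : ℕ, (cyclicSucc P)^[m] u = v then
    (Finset.range (Nat.find h + 1)).image (fun j => (cyclicSucc P)^[j] u)
  else ∅

/-- The orbit `ā = {a + iℓ : 0 ≤ i ≤ d−1} ⊆ [dℓ]` of `a ∈ [ℓ]`. -/
def orbit (d ℓ a : ℕ) : Finset ℕ := (Finset.range d).image (fun i => a + i * ℓ)

/-- `P_s = [n] \ (ā_{a_1} ∪ … ∪ ā_{a_{s−1}})`, where `n = dℓ`. -/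
def Pset (d ℓ : ℕ) (a : ℕ → ℕ) (s : ℕ) : Finset ℕ :=
  Finset.Icc 1 (d * ℓ) \ (Finset.Icc 1 (s - 1)).biUnion (fun i => orbit d ℓ (a i))

/-- `P_{s,h} = P_s \ {a_s +_n hℓ, …, a_s +_n (d−1)ℓ}` for `1 ≤ h ≤ d−1`; `P_{s,d} = P_s`. -/
def Psh (d ℓ : ℕ) (a : ℕ → ℕ) (s h : ℕ) : Finset ℕ :=
  Pset d ℓ a s \ (Finset.Ico h d).image (fun j => shiftMod (d * ℓ) (j * ℓ) (a s))

/-- `I(i,h) = {i, S_{P_{s,h}}(i), S_{P_{s,h}}²(i), …, S_{P_{s,h}}^{k−1}(i)}`. -/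
def Iih (d ℓ k : ℕ) (a : ℕ → ℕ) (s h i : ℕ) : Finset ℕ :=
  (Finset.range k).image (fun j => (cyclicSucc (Psh d ℓ a s h))^[j] i)

/-- `B_s = {I(i,h) : i` in the cyclic interval of `P_s` from `S_{P_s}(a_s +_n (n−ℓ))` to
`a_s`, `1 ≤ h ≤ d`, `|I(i,h)| = k}`. -/
noncomputable def Bset (d ℓ k : ℕ) (a : ℕ → ℕ) (s : ℕ) : Finset (Finset ℕ) :=
  (((cyclicIntervalTo (Pset d ℓ a s)
        (cyclicSucc (Pset d ℓ a s) (shiftMod (d * ℓ) (d * ℓ - ℓ) (a s)))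
        (a s)) ×ˢ (Finset.Icc 1 d)).image
      (fun p => Iih d ℓ k a s p.2 p.1)).filter (fun I => I.card = k)

/-- `L_s = {I +_n xℓ : I ∈ B_s, 1 ≤ x ≤ d}`. -/
noncomputable def Lset (d ℓ k : ℕ) (a : ℕ → ℕ) (s : ℕ) : Finset (Finset ℕ) :=
  ((Bset d ℓ k a s) ×ˢ (Finset.Icc 1 d)).image (fun p => shiftSet (d * ℓ) (p.2 * ℓ) p.1)

/-- The output collection `D = L_1 ∪ … ∪ L_{ℓ−r+1}`. -/
noncomputable def Dcol (d ℓ k r : ℕ) (a : ℕ → ℕ) : Finset (Finset ℕ) :=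
  (Finset.Icc 1 (ℓ - r + 1)).biUnion (fun s => Lset d ℓ k a s)

/-- The map `F : [n] → [dℓ]`, `F(a + gx) = a + ℓx` for `1 ≤ a ≤ g`, `0 ≤ x ≤ d−1`. -/
def Fmap (g ℓ y : ℕ) : ℕ := (y - 1) % g + 1 + ℓ * ((y - 1) / g)

/-- The number of steps, walking upwards cyclically through `[n]`, from `i` to `x`. -/
def cycDist (n i x : ℕ) : ℕ := if i ≤ x then x - i else x + n - i

/-- The rank (counted from `1`) of `x` in `S` when `S` is ordered by the key `g`. -/
def rankIn (S : Finset ℕ) (g : ℕ → ℕ) (x : ℕ) : ℕ := #{y ∈ S | g y ≤ g x}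

/-- The first `k` elements of `S` with respect to the key `g`. -/
def initSeg (S : Finset ℕ) (g : ℕ → ℕ) (k : ℕ) : Finset ℕ := {x ∈ S | rankIn S g x ≤ k}

/-- `P` without the elements of `A` that lie cyclically after `o`, starting from `i`. -/
def truncSet (n : ℕ) (P A : Finset ℕ) (i o : ℕ) : Finset ℕ :=
  {x ∈ P | x ∉ A ∨ cycDist n i x ≤ cycDist n i o}

/-- The first `k` elements of `truncSet n P A i o`, starting from `i`. -/
def truncSeg (n k : ℕ) (P A : Finset ℕ) (i o : ℕ) : Finset ℕ :=
  initSeg (truncSet n P A i o) (cycDist n i) k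

/-! ### Initial segments -/

lemma rankIn_lt_rankIn {S : Finset ℕ} {g : ℕ → ℕ} {x y : ℕ} (hy : y ∈ S) (h : g x < g y) :
    rankIn S g x < rankIn S g y := by
  apply Finset.card_lt_card
  rw [Finset.ssubset_iff_of_subset]
  · exact ⟨y, by simp [hy], by simp [h]⟩
  · intro z hz
    simp only [Finset.mem_filter] at hz ⊢
    exact ⟨hz.1, by omega⟩

lemma rankIn_mono {S : Finset ℕ} {g : ℕ → ℕ} {x y : ℕ} (h : g x ≤ g y) :
    rankIn S g x ≤ rankIn S g y := by
  apply Finset.card_le_card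
  intro z hz
  simp only [Finset.mem_filter] at hz ⊢
  exact ⟨hz.1, by omega⟩

lemma rankIn_le_iff {S : Finset ℕ} {g : ℕ → ℕ} {x y : ℕ} (hx : x ∈ S) :
    rankIn S g x ≤ rankIn S g y ↔ g x ≤ g y := by
  refine ⟨fun h => ?_, rankIn_mono⟩
  by_contra! hlt
  exact absurd (rankIn_lt_rankIn hx hlt) (by omega)

lemma rankIn_pos {S : Finset ℕ} {g : ℕ → ℕ} {x : ℕ} (hx : x ∈ S) : 1 ≤ rankIn S g x :=
  Finset.card_pos.2 ⟨x, by simp [hx]⟩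

lemma rankIn_le_card (S : Finset ℕ) (g : ℕ → ℕ) (x : ℕ) : rankIn S g x ≤ #S :=
  Finset.card_filter_le _ _

lemma rankIn_injOn {S : Finset ℕ} {g : ℕ → ℕ} (hg : Set.InjOn g S) :
    Set.InjOn (rankIn S g) S := by
  intro x hx y hy h
  exact hg hx hy (le_antisymm ((rankIn_le_iff hx).1 h.le) ((rankIn_le_iff hy).1 h.ge))

lemma image_rankIn {S : Finset ℕ} {g : ℕ → ℕ} (hg : Set.InjOn g S) :
    S.image (rankIn S g) = Finset.Icc 1 #S := by
  apply Finset.eq_of_subset_of_card_le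
  · intro m hm
    obtain ⟨x, hx, rfl⟩ := Finset.mem_image.1 hm
    exact Finset.mem_Icc.2 ⟨rankIn_pos hx, rankIn_le_card _ _ _⟩
  · rw [Finset.card_image_of_injOn (rankIn_injOn hg)]
    simp

lemma initSeg_subset (S : Finset ℕ) (g : ℕ → ℕ) (k : ℕ) : initSeg S g k ⊆ S :=
  Finset.filter_subset _ _

lemma card_initSeg {S : Finset ℕ} {g : ℕ → ℕ} (hg : Set.InjOn g S) (k : ℕ) :
    #(initSeg S g k) = min k #S := by
  have h : (initSeg S g k).image (rankIn S g) = Finset.Icc 1 (min k #S) := by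
    ext m
    have := Finset.ext_iff.1 (image_rankIn hg) m
    simp only [Finset.mem_image, Finset.mem_Icc, initSeg, Finset.mem_filter] at this ⊢
    constructor
    · rintro ⟨x, ⟨hx, hk⟩, rfl⟩
      have := rankIn_pos (g := g) hx
      have := rankIn_le_card S g x
      omega
    · intro hm
      obtain ⟨x, hx, rfl⟩ := this.2 (by omega)
      exact ⟨x, ⟨hx, by omega⟩, rfl⟩
  rw [← Finset.card_image_of_injOn ((rankIn_injOn hg).mono (s₁ := initSeg S g k)
    (Finset.coe_subset.2 (initSeg_subset S g k))), h]
  simp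

lemma initSeg_lower {S : Finset ℕ} {g : ℕ → ℕ} {k x y : ℕ} (hx : x ∈ initSeg S g k)
    (hy : y ∈ S) (h : g y ≤ g x) : y ∈ initSeg S g k := by
  simp only [initSeg, Finset.mem_filter] at hx ⊢
  exact ⟨hy, (rankIn_mono h).trans hx.2⟩

/-- A subset of size `k` that is downward closed is the initial segment of size `k`. -/
lemma eq_initSeg {S X : Finset ℕ} {g : ℕ → ℕ} {k : ℕ} (hg : Set.InjOn g S) (hXS : X ⊆ S)
    (hX : #X = k) (hlow : ∀ x ∈ X, ∀ y ∈ S, g y ≤ g x → y ∈ X) : X = initSeg S g k := by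
  apply Finset.eq_of_subset_of_card_le
  · intro x hx
    simp only [initSeg, Finset.mem_filter]
    refine ⟨hXS hx, hX ▸ Finset.card_le_card ?_⟩
    intro y hy
    simp only [Finset.mem_filter] at hy
    exact hlow x hx y hy.1 hy.2
  · rw [card_initSeg hg, hX]
    exact min_le_left _ _

lemma initSeg_eq_initSeg_of_subset {S S' : Finset ℕ} {g : ℕ → ℕ} {k : ℕ} (hg : Set.InjOn g S)
    (hk : k ≤ #S) (hS : S' ⊆ S) (h : initSeg S g k ⊆ S') : initSeg S g k = initSeg S' g k := by
  apply eq_initSeg (hg.mono (by exact_mod_cast hS)) h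
  · rw [card_initSeg hg, min_eq_left hk]
  · intro x hx y hy hxy
    exact initSeg_lower hx (hS hy) hxy

lemma image_initSeg {S : Finset ℕ} {g g' σ : ℕ → ℕ} (k : ℕ) (hσ : Set.InjOn σ S)
    (h : ∀ x ∈ S, g' (σ x) = g x) :
    (initSeg S g k).image σ = initSeg (S.image σ) g' k := by
  have hr : ∀ x ∈ S, rankIn (S.image σ) g' (σ x) = rankIn S g x := by
    intro x hx
    have : {y ∈ S.image σ | g' y ≤ g' (σ x)} = ({y ∈ S | g y ≤ g x}).image σ := by
      ext z
      simp only [Finset.mem_filter, Finset.mem_image]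
      constructor
      · rintro ⟨⟨y, hy, rfl⟩, hz⟩
        rw [h y hy, h x hx] at hz
        exact ⟨y, ⟨hy, hz⟩, rfl⟩
      · rintro ⟨y, ⟨hy, hz⟩, rfl⟩
        rw [h y hy, h x hx]
        exact ⟨⟨y, hy, rfl⟩, hz⟩
    rw [rankIn, this, Finset.card_image_of_injOn 
      (hσ.mono (Finset.coe_subset.2 (Finset.filter_subset _ _))), rankIn]
  ext z
  simp only [initSeg, Finset.mem_filter, Finset.mem_image]
  constructor
  · rintro ⟨y, ⟨hy, hz⟩, rfl⟩
    exact ⟨⟨y, hy, rfl⟩, by rwa [hr y hy]⟩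
  · rintro ⟨⟨y, hy, rfl⟩, hz⟩
    exact ⟨y, ⟨hy, by rwa [hr y hy] at hz⟩, rfl⟩

/-! ### Cyclic distance -/

lemma cycDist_injOn {n i : ℕ} (hi : i ∈ Finset.Icc 1 n) :
    Set.InjOn (cycDist n i) (Finset.Icc 1 n : Finset ℕ) := by
  intro x hx y hy h
  simp only [Finset.coe_Icc, Set.mem_Icc, Finset.mem_Icc, cycDist] at *
  split_ifs at h <;> omega

lemma cycDist_left_injOn {n o : ℕ} (ho : o ∈ Finset.Icc 1 n) :
    Set.InjOn (fun i => cycDist n i o) (Finset.Icc 1 n : Finset ℕ) := by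
  intro x hx y hy h
  simp only [Finset.coe_Icc, Set.mem_Icc, Finset.mem_Icc, cycDist] at *
  split_ifs at h <;> omega

lemma cycDist_self (n i : ℕ) : cycDist n i i = 0 := by simp [cycDist]

/-- Both conditions say that `y` lies on the cyclic arc from `i` to `o`. -/
lemma cycDist_le_iff {n i o y : ℕ} (hi : i ∈ Finset.Icc 1 n) (ho : o ∈ Finset.Icc 1 n)
    (hy : y ∈ Finset.Icc 1 n) : cycDist n i y ≤ cycDist n i o ↔ cycDist n y o ≤ cycDist n i o := by
  simp only [Finset.mem_Icc, cycDist] at *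
  split_ifs <;> omega

lemma eq_of_cycDist_lt {n i j z : ℕ} (hi : i ∈ Finset.Icc 1 n) (hj : j ∈ Finset.Icc 1 n)
    (hz : z ∈ Finset.Icc 1 n) (h₁ : cycDist n i j < cycDist n i z)
    (h₂ : cycDist n j i < cycDist n j z) : i = j := by
  simp only [Finset.mem_Icc, cycDist] at *
  split_ifs at * <;> omega

/-! ### Truncated segments -/

section Trunc

lemma truncSet_subset (n : ℕ) (P A : Finset ℕ) (i o : ℕ) : truncSet n P A i o ⊆ P :=
  Finset.filter_subset _ _

lemma sdiff_subset_truncSet (n : ℕ) (P A : Finset ℕ) (i o : ℕ) : P \ A ⊆ truncSet n P A i o := by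
  intro x hx
  simp only [Finset.mem_sdiff, truncSet, Finset.mem_filter] at *
  tauto

lemma mem_truncSet_right {n : ℕ} {P A : Finset ℕ} {i o : ℕ} (ho : o ∈ P) :
    o ∈ truncSet n P A i o := by
  simp [truncSet, ho]

lemma mem_truncSet_left {n : ℕ} {P A : Finset ℕ} {i o : ℕ} (hi : i ∈ P) :
    i ∈ truncSet n P A i o := by
  simp [truncSet, hi, cycDist_self]

lemma truncSeg_subset (n k : ℕ) (P A : Finset ℕ) (i o : ℕ) : truncSeg n k P A i o ⊆ P :=
  (initSeg_subset _ _ _).trans (truncSet_subset _ _ _ _ _)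

variable {n k : ℕ} {P A : Finset ℕ} {i o : ℕ}

lemma cycDist_injOn_truncSet (hP : P ⊆ Finset.Icc 1 n) (hi : i ∈ P) :
    Set.InjOn (cycDist n i) (truncSet n P A i o) :=
  (cycDist_injOn (hP hi)).mono (by exact_mod_cast (truncSet_subset _ _ _ _ _).trans hP)

lemma card_truncSeg (hP : P ⊆ Finset.Icc 1 n) (hi : i ∈ P)
    (hk : k ≤ #(truncSet n P A i o)) : #(truncSeg n k P A i o) = k := by
  rw [truncSeg, card_initSeg (cycDist_injOn_truncSet hP hi), min_eq_left hk]

lemma mem_truncSeg_left (hP : P ⊆ Finset.Icc 1 n) (hi : i ∈ P) (hk1 : 1 ≤ k)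
    (hk : k ≤ #(truncSet n P A i o)) : i ∈ truncSeg n k P A i o := by
  have hc := card_truncSeg hP hi hk
  obtain ⟨x, hx⟩ : (truncSeg n k P A i o).Nonempty := Finset.card_pos.1 (by omega)
  exact initSeg_lower hx (mem_truncSet_left hi) (by simp [cycDist_self])

/-- `o` survives in the segment exactly when the arc of `P` from `i` to `o` has at most `k`
elements. -/
lemma mem_truncSeg_right_iff (hP : P ⊆ Finset.Icc 1 n) (hi : i ∈ P) (ho : o ∈ P) :
    o ∈ truncSeg n k P A i o ↔ i ∈ initSeg P (fun x => cycDist n x o) k := by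
  have h : rankIn (truncSet n P A i o) (cycDist n i) o = rankIn P (fun x => cycDist n x o) i := by
    unfold rankIn
    congr 1
    ext y
    simp only [Finset.mem_filter, truncSet]
    constructor
    · rintro ⟨⟨hy, -⟩, h⟩
      exact ⟨hy, (cycDist_le_iff (hP hi) (hP ho) (hP hy)).1 h⟩
    · rintro ⟨hy, h⟩
      have := (cycDist_le_iff (hP hi) (hP ho) (hP hy)).2 h
      exact ⟨⟨hy, Or.inr this⟩, this⟩
  simp only [truncSeg, initSeg, Finset.mem_filter, h, mem_truncSet_right ho, hi]

/-- A segment meeting `A` is the segment truncated at its last element of `A`. -/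
lemma exists_truncSeg_eq (hP : P ⊆ Finset.Icc 1 n) (hi : i ∈ P)
    (hk : k ≤ #(truncSet n P A i o)) (hne : (truncSeg n k P A i o ∩ A).Nonempty) :
    ∃ o' ∈ A, o' ∈ truncSeg n k P A i o' ∧ truncSeg n k P A i o = truncSeg n k P A i o' := by
  obtain ⟨o', ho', hmax⟩ := Finset.exists_max_image _ (cycDist n i) hne
  rw [Finset.mem_inter] at ho'
  have hle : cycDist n i o' ≤ cycDist n i o := by
    have := initSeg_subset _ _ _ ho'.1
    simp only [truncSet, Finset.mem_filter] at this
    tauto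
  have heq : truncSeg n k P A i o = truncSeg n k P A i o' := by
    apply initSeg_eq_initSeg_of_subset (cycDist_injOn_truncSet hP hi) hk
    · intro x hx
      simp only [truncSet, Finset.mem_filter] at hx ⊢
      refine ⟨hx.1, hx.2.imp id fun h => by omega⟩
    · intro x hx
      simp only [truncSet, Finset.mem_filter]
      refine ⟨truncSeg_subset _ _ _ _ _ _ hx, ?_⟩
      by_cases hxA : x ∈ A
      · exact Or.inr (hmax x (Finset.mem_inter.2 ⟨hx, hxA⟩))
      · exact Or.inl hxA
  exact ⟨o', ho'.2, heq ▸ ho'.1, heq⟩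

/-- The parameters of a segment that misses some element outside `A` are determined by it. -/
lemma truncSeg_inj {i' o' z : ℕ} (hP : P ⊆ Finset.Icc 1 n) (hA : A ⊆ P) (hk1 : 1 ≤ k)
    (hi : i ∈ P) (hi' : i' ∈ P) (ho : o ∈ A) (ho' : o' ∈ A)
    (hk : k ≤ #(truncSet n P A i o)) (hk' : k ≤ #(truncSet n P A i' o'))
    (hoT : o ∈ truncSeg n k P A i o) (hoT' : o' ∈ truncSeg n k P A i' o')
    (heq : truncSeg n k P A i o = truncSeg n k P A i' o')
    (hz : z ∈ P \ A) (hzW : z ∉ truncSeg n k P A i o) : i = i' ∧ o = o' := by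
  have hzP : z ∈ P := (Finset.mem_sdiff.1 hz).1
  have hii : i = i' := by
    apply eq_of_cycDist_lt (hP hi) (hP hi') (hP hzP)
    · by_contra! h
      have hm : i' ∈ truncSeg n k P A i o := heq ▸ mem_truncSeg_left hP hi' hk1 hk'
      exact hzW (initSeg_lower hm (sdiff_subset_truncSet _ _ _ _ _ hz) h)
    · by_contra! h
      have hm : i ∈ truncSeg n k P A i' o' := heq ▸ mem_truncSeg_left hP hi hk1 hk
      exact (heq ▸ hzW) (initSeg_lower hm (sdiff_subset_truncSet _ _ _ _ _ hz) h)
  subst hii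
  refine ⟨rfl, cycDist_injOn (hP hi) (hP (hA ho)) (hP (hA ho')) (le_antisymm ?_ ?_)⟩
  · have := initSeg_subset _ _ _ (heq ▸ hoT)
    simp only [truncSet, Finset.mem_filter] at this
    tauto
  · have := initSeg_subset _ _ _ (heq ▸ hoT')
    simp only [truncSet, Finset.mem_filter] at this
    tauto

end Trunc

/-! ### Counting truncated segments -/

/-- All truncated segments with `k` elements. -/
def segFamily (n k : ℕ) (P A : Finset ℕ) : Finset (Finset ℕ) :=
  {p ∈ P ×ˢ A | k ≤ #(truncSet n P A p.1 p.2)}.image fun p => truncSeg n k P A p.1 p.2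

/-- The truncated segments with `k` elements that meet `A`. -/
def meetFamily (n k : ℕ) (P A : Finset ℕ) : Finset (Finset ℕ) :=
  {W ∈ segFamily n k P A | (W ∩ A).Nonempty}

/-- The pairs `(i, o)` for which `o` belongs to the segment it defines. -/
def markedPairs (n k : ℕ) (P A : Finset ℕ) : Finset (ℕ × ℕ) :=
  {p ∈ P ×ˢ A | p.2 ∈ truncSeg n k P A p.1 p.2}

section Count

variable {n k : ℕ} {P A : Finset ℕ}

lemma mem_segFamily {W : Finset ℕ} : W ∈ segFamily n k P A ↔
    ∃ i ∈ P, ∃ o ∈ A, k ≤ #(truncSet n P A i o) ∧ truncSeg n k P A i o = W := by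
  simp only [segFamily, Finset.mem_image, Finset.mem_filter, Finset.mem_product, Prod.exists]
  constructor
  · rintro ⟨i, o, ⟨⟨hi, ho⟩, hk⟩, h⟩
    exact ⟨i, hi, o, ho, hk, h⟩
  · rintro ⟨i, hi, o, ho, hk, h⟩
    exact ⟨i, o, ⟨⟨hi, ho⟩, hk⟩, h⟩

lemma mem_markedPairs {p : ℕ × ℕ} : p ∈ markedPairs n k P A ↔
    p.1 ∈ P ∧ p.2 ∈ A ∧ p.2 ∈ truncSeg n k P A p.1 p.2 := by
  simp [markedPairs, and_assoc]

lemma subset_of_mem_segFamily {W : Finset ℕ} (hW : W ∈ segFamily n k P A) : W ⊆ P := by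
  obtain ⟨i, -, o, -, -, rfl⟩ := mem_segFamily.1 hW
  exact truncSeg_subset _ _ _ _ _ _

lemma card_of_mem_segFamily (hP : P ⊆ Finset.Icc 1 n) {W : Finset ℕ}
    (hW : W ∈ segFamily n k P A) : #W = k := by
  obtain ⟨i, hi, o, -, hk, rfl⟩ := mem_segFamily.1 hW
  exact card_truncSeg hP hi hk

lemma card_markedPairs (hP : P ⊆ Finset.Icc 1 n) (hA : A ⊆ P) (hk : k ≤ #P) :
    #(markedPairs n k P A) = k * #A := by
  rw [Finset.card_eq_sum_card_fiberwise (f := Prod.snd) (t := A)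
    (fun p hp => (mem_markedPairs.1 hp).2.1), Finset.sum_const_nat (m := k), mul_comm]
  intro o ho
  have h : {p ∈ markedPairs n k P A | p.2 = o} =
      (initSeg P (fun x => cycDist n x o) k).image fun i => (i, o) := by
    ext ⟨i, o'⟩
    simp only [Finset.mem_filter, mem_markedPairs, Finset.mem_image, Prod.mk.injEq]
    constructor
    · rintro ⟨⟨hi, -, h⟩, rfl⟩
      exact ⟨i, (mem_truncSeg_right_iff hP hi (hA ho)).1 h, rfl, rfl⟩
    · rintro ⟨i, h, rfl, rfl⟩
      have hi := initSeg_subset _ _ _ h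
      exact ⟨⟨hi, ho, (mem_truncSeg_right_iff hP hi (hA ho)).2 h⟩, rfl⟩
  rw [h, Finset.card_image_of_injective _ (fun _ _ h => (Prod.mk.inj h).1),
    card_initSeg ((cycDist_left_injOn (hP (hA ho))).mono (Finset.coe_subset.2 hP)),
    min_eq_left hk]

lemma insert_sdiff_subset_truncSet (hA : A ⊆ P) {o : ℕ} (ho : o ∈ A) (i : ℕ) :
    insert o (P \ A) ⊆ truncSet n P A i o :=
  Finset.insert_subset (mem_truncSet_right (hA ho)) (sdiff_subset_truncSet _ _ _ _ _)

lemma card_insert_sdiff {o : ℕ} (ho : o ∈ A) : #(insert o (P \ A)) = #(P \ A) + 1 :=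
  Finset.card_insert_of_notMem (by simp [ho])

lemma le_card_truncSet (hA : A ⊆ P) (hk : k ≤ #(P \ A) + 1) {o : ℕ} (ho : o ∈ A) (i : ℕ) :
    k ≤ #(truncSet n P A i o) :=
  hk.trans ((card_insert_sdiff ho).symm.trans_le
    (Finset.card_le_card (insert_sdiff_subset_truncSet hA ho i)))

/-- The segments that meet `A` are those given by marked pairs. -/
lemma meetFamily_eq_image (hP : P ⊆ Finset.Icc 1 n) (hA : A ⊆ P) (hk : k ≤ #(P \ A) + 1) :
    meetFamily n k P A = (markedPairs n k P A).image fun p => truncSeg n k P A p.1 p.2 := by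
  ext W
  simp only [meetFamily, Finset.mem_filter, mem_segFamily, Finset.mem_image, mem_markedPairs,
    Prod.exists]
  constructor
  · rintro ⟨⟨i, hi, o, ho, hV, rfl⟩, hne⟩
    obtain ⟨o', ho', hm, h⟩ := exists_truncSeg_eq hP hi hV hne
    exact ⟨i, o', ⟨hi, ho', hm⟩, h.symm⟩
  · rintro ⟨i, o, ⟨hi, ho, hm⟩, rfl⟩
    exact ⟨⟨i, hi, o, ho, le_card_truncSet hA hk ho i, rfl⟩, o, Finset.mem_inter.2 ⟨hm, ho⟩⟩

lemma card_meetFamily (hP : P ⊆ Finset.Icc 1 n) (hA : A ⊆ P) (hk1 : 1 ≤ k)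
    (hk : k ≤ #(P \ A)) :
    #(meetFamily n k P A) = k * #A := by
  rw [meetFamily_eq_image hP hA (by omega), Finset.card_image_of_injOn,
    card_markedPairs hP hA (hk.trans (Finset.card_le_card Finset.sdiff_subset))]
  rintro ⟨i, o⟩ h ⟨i', o'⟩ h' heq
  obtain ⟨hi, ho, hm⟩ := mem_markedPairs.1 h
  obtain ⟨hi', ho', hm'⟩ := mem_markedPairs.1 h'
  dsimp only at *
  have hV := le_card_truncSet (n := n) hA (by omega : k ≤ #(P \ A) + 1) ho i
  obtain ⟨z, hz, hzW⟩ : ∃ z ∈ P \ A, z ∉ truncSeg n k P A i o := by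
    by_contra! hall
    have := Finset.card_le_card (Finset.insert_subset hm hall)
    rw [card_insert_sdiff ho, card_truncSeg hP hi hV] at this
    omega
  obtain ⟨rfl, rfl⟩ := truncSeg_inj hP hA hk1 hi hi' ho ho' hV
    (le_card_truncSet hA (by omega) ho' i') hm hm' heq hz hzW
  rfl

/-- The pairs `(i, o)` with `i ∉ A` and `o` the first element of `A` after `i`. -/
def firstPairs (n : ℕ) (P A : Finset ℕ) : Finset (ℕ × ℕ) :=
  {p ∈ (P \ A) ×ˢ A | ∀ o ∈ A, cycDist n p.1 p.2 ≤ cycDist n p.1 o}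

lemma mem_firstPairs {p : ℕ × ℕ} : p ∈ firstPairs n P A ↔
    p.1 ∈ P \ A ∧ p.2 ∈ A ∧ ∀ o ∈ A, cycDist n p.1 p.2 ≤ cycDist n p.1 o := by
  simp only [firstPairs, Finset.mem_filter, Finset.mem_product, and_assoc]

lemma card_firstPairs (hP : P ⊆ Finset.Icc 1 n) (hA : A ⊆ P) (hne : A.Nonempty) :
    #(firstPairs n P A) = #(P \ A) := by
  have h : (firstPairs n P A).image Prod.fst = P \ A := by
    ext i
    simp only [Finset.mem_image, mem_firstPairs, Prod.exists, exists_and_right, exists_eq_right]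
    constructor
    · rintro ⟨o, hi, -⟩
      exact hi
    · intro hi
      obtain ⟨o, ho, hmin⟩ := Finset.exists_min_image A (cycDist n i) hne
      exact ⟨o, hi, ho, hmin⟩
  rw [← h, Finset.card_image_of_injOn]
  rintro ⟨i, o⟩ hp ⟨i', o'⟩ hp' rfl
  obtain ⟨hi, ho, hmin⟩ := mem_firstPairs.1 hp
  obtain ⟨-, ho', hmin'⟩ := mem_firstPairs.1 hp'
  have := cycDist_injOn (hP (Finset.sdiff_subset hi)) (hP (hA ho)) (hP (hA ho'))
    (le_antisymm (hmin _ ho') (hmin' _ ho))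
  simp_all

/-- If `o` is the first element of `A` after `i` then no other element of `A` survives. -/
lemma truncSet_eq_insert (hP : P ⊆ Finset.Icc 1 n) (hA : A ⊆ P) {i o : ℕ} (hi : i ∈ P)
    (ho : o ∈ A) (hmin : ∀ o' ∈ A, cycDist n i o ≤ cycDist n i o') :
    truncSet n P A i o = insert o (P \ A) := by
  apply Finset.Subset.antisymm _ (insert_sdiff_subset_truncSet hA ho i)
  intro x hx
  simp only [truncSet, Finset.mem_filter, Finset.mem_insert, Finset.mem_sdiff] at hx ⊢
  by_cases hxA : x ∈ A
  · left
    exact cycDist_injOn (hP hi) (hP hx.1) (hP (hA ho))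
      (le_antisymm (hx.2.resolve_left (not_not.2 hxA)) (hmin x hxA))
  · exact Or.inr ⟨hx.1, hxA⟩

lemma truncSeg_eq_insert (hP : P ⊆ Finset.Icc 1 n) (hA : A ⊆ P) {i o : ℕ} (hi : i ∈ P)
    (ho : o ∈ A) (hk : k = #(P \ A) + 1)
    (hmin : ∀ o' ∈ A, cycDist n i o ≤ cycDist n i o') :
    truncSeg n k P A i o = insert o (P \ A) := by
  have hc := card_truncSeg hP hi (le_card_truncSet hA hk.le ho i)
  rw [← truncSet_eq_insert hP hA hi ho hmin]
  refine Finset.eq_of_subset_of_card_le (t := truncSet n P A i o) (initSeg_subset _ _ _) ?_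
  rw [hc, truncSet_eq_insert hP hA hi ho hmin, card_insert_sdiff ho, hk]

lemma card_meetFamily_of_eq (hP : P ⊆ Finset.Icc 1 n) (hA : A ⊆ P) (hne : A.Nonempty)
    (hk : k = #(P \ A) + 1) :
    #(meetFamily n k P A) = k * #A - #(P \ A) := by
  have hkP : k ≤ #P := by
    obtain ⟨o, ho⟩ := hne
    rw [hk, ← card_insert_sdiff ho]
    exact Finset.card_le_card (Finset.insert_subset (hA ho) Finset.sdiff_subset)
  have hsub : firstPairs n P A ⊆ markedPairs n k P A := by
    rintro ⟨i, o⟩ h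
    obtain ⟨hi, ho, hmin⟩ := mem_firstPairs.1 h
    have hi := Finset.sdiff_subset hi
    refine mem_markedPairs.2 ⟨hi, ho, ?_⟩
    rw [truncSeg_eq_insert hP hA hi ho hk hmin]
    exact Finset.mem_insert_self _ _
  have himg : ((markedPairs n k P A).image fun p => truncSeg n k P A p.1 p.2) =
      (markedPairs n k P A \ firstPairs n P A).image fun p => truncSeg n k P A p.1 p.2 := by
    apply Finset.Subset.antisymm _ (Finset.image_subset_image Finset.sdiff_subset)
    intro W hW
    obtain ⟨⟨i, o⟩, hp, rfl⟩ := Finset.mem_image.1 hW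
    by_cases hf : (i, o) ∈ firstPairs n P A
    · obtain ⟨hi, ho, hmin⟩ := mem_firstPairs.1 hf
      have hoo : truncSeg n k P A o o = insert o (P \ A) :=
        truncSeg_eq_insert hP hA (hA ho) ho hk (by simp [cycDist_self])
      refine Finset.mem_image.2 ⟨(o, o), Finset.mem_sdiff.2 ⟨mem_markedPairs.2
        ⟨hA ho, ho, by simp [hoo]⟩, ?_⟩, ?_⟩
      · simp [mem_firstPairs, ho]
      · dsimp only
        rw [hoo, truncSeg_eq_insert hP hA (Finset.sdiff_subset hi) ho hk hmin]
    · exact Finset.mem_image_of_mem _ (Finset.mem_sdiff.2 ⟨hp, hf⟩)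
  rw [meetFamily_eq_image hP hA hk.le, himg, Finset.card_image_of_injOn,
    Finset.card_sdiff_of_subset hsub, card_markedPairs hP hA hkP, card_firstPairs hP hA hne]
  have key : ∀ i o, (i, o) ∈ markedPairs n k P A \ firstPairs n P A →
      P \ A ⊆ truncSeg n k P A i o → i = o ∧ ∀ x ∈ A, x ∈ truncSeg n k P A i o → x = o := by
    intro i o h hall
    obtain ⟨hm, hf⟩ := Finset.mem_sdiff.1 h
    obtain ⟨hi, ho, hm⟩ := mem_markedPairs.1 hm
    have hV := le_card_truncSet (n := n) hA hk.le ho i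
    have hW : insert o (P \ A) = truncSeg n k P A i o := by
      apply Finset.eq_of_subset_of_card_le (Finset.insert_subset hm hall)
      rw [card_insert_sdiff ho, card_truncSeg hP hi hV, hk]
    have huniq : ∀ x ∈ A, x ∈ truncSeg n k P A i o → x = o := by
      intro x hx hxW
      rw [← hW] at hxW
      simpa [hx] using hxW
    refine ⟨?_, huniq⟩
    by_cases hiA : i ∈ A
    · exact huniq i hiA (mem_truncSeg_left hP hi (by omega) hV)
    · exfalso
      apply hf
      refine mem_firstPairs.2 ⟨Finset.mem_sdiff.2 ⟨hi, hiA⟩, ho, fun o' ho' => ?_⟩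
      by_contra! hlt
      have ho'W : o' ∈ truncSeg n k P A i o := by
        refine initSeg_lower hm ?_ hlt.le
        simp only [truncSet, Finset.mem_filter]
        exact ⟨hA ho', Or.inr hlt.le⟩
      have := huniq o' ho' ho'W
      subst this
      exact lt_irrefl _ hlt
  rintro ⟨i, o⟩ h ⟨i', o'⟩ h' heq
  obtain ⟨hi, ho, hm⟩ := mem_markedPairs.1 (Finset.mem_sdiff.1 h).1
  obtain ⟨hi', ho', hm'⟩ := mem_markedPairs.1 (Finset.mem_sdiff.1 h').1
  dsimp only at *
  by_cases hall : P \ A ⊆ truncSeg n k P A i o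
  · obtain ⟨rfl, hu⟩ := key i o h hall
    obtain ⟨rfl, -⟩ := key i' o' h' (heq ▸ hall)
    rw [hu i' ho' (heq ▸ hm')]
  · obtain ⟨z, hz, hzW⟩ := Finset.not_subset.1 hall
    obtain ⟨rfl, rfl⟩ := truncSeg_inj hP hA (by omega) hi hi' ho ho'
      (le_card_truncSet hA hk.le ho i) (le_card_truncSet hA hk.le ho' i') hm hm' heq hz hzW
    rfl

/-- Truncating at the last element of `A` does nothing. -/
lemma exists_truncSet_eq (hA : A.Nonempty) (i : ℕ) :
    ∃ o ∈ A, truncSet n P A i o = P := by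
  obtain ⟨o, ho, hmax⟩ := Finset.exists_max_image A (cycDist n i) hA
  refine ⟨o, ho, Finset.filter_true_of_mem fun x _ => ?_⟩
  by_cases hx : x ∈ A
  · exact Or.inr (hmax x hx)
  · exact Or.inl hx

/-- A segment of `P` avoiding `A` is also a segment of `P \ A`. -/
lemma mem_segFamily_sdiff {A' W : Finset ℕ} (hP : P ⊆ Finset.Icc 1 n)
    (hA' : A'.Nonempty) (hk1 : 1 ≤ k) (hW : W ∈ segFamily n k P A) (hWA : ¬ (W ∩ A).Nonempty) :
    W ∈ segFamily n k (P \ A) A' := by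
  obtain ⟨i, hi, o, ho, hk, rfl⟩ := mem_segFamily.1 hW
  have hsub : truncSeg n k P A i o ⊆ P \ A := by
    intro x hx
    refine Finset.mem_sdiff.2 ⟨truncSeg_subset _ _ _ _ _ _ hx, fun hxA => hWA ⟨x, ?_⟩⟩
    exact Finset.mem_inter.2 ⟨hx, hxA⟩
  have hiQ := hsub (mem_truncSeg_left hP hi hk1 hk)
  obtain ⟨o', ho', hV⟩ := exists_truncSet_eq (n := n) hA' i
  refine mem_segFamily.2 ⟨i, hiQ, o', ho', ?_, ?_⟩
  · rw [hV, ← card_truncSeg hP hi hk]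
    exact Finset.card_le_card hsub
  · rw [truncSeg, hV]
    exact (initSeg_eq_initSeg_of_subset (cycDist_injOn_truncSet hP hi) hk
      (sdiff_subset_truncSet _ _ _ _ _) hsub).symm

lemma segFamily_eq_empty (hk : #P < k) : segFamily n k P A = ∅ := by
  ext W
  simp only [mem_segFamily, Finset.notMem_empty, iff_false]
  rintro ⟨i, -, o, -, h, -⟩
  have := Finset.card_le_card (truncSet_subset n P A i o)
  omega

lemma segFamily_eq_powersetCard (hP : P ⊆ Finset.Icc 1 n) (hA : A ⊆ P) (hne : A.Nonempty)
    (hk1 : 1 ≤ k) (hk : k ≤ #P) (hPk : #P ≤ k + 1) :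
    segFamily n k P A = P.powersetCard k := by
  ext W
  rw [Finset.mem_powersetCard]
  refine ⟨fun h => ⟨subset_of_mem_segFamily h, card_of_mem_segFamily hP h⟩, ?_⟩
  rintro ⟨hWP, hWk⟩
  obtain ⟨i, hiP, hi⟩ : ∃ i ∈ P, ∀ x ∈ W, ∀ y ∈ P, cycDist n i y ≤ cycDist n i x → y ∈ W := by
    by_cases hPW : P ⊆ W
    · obtain ⟨o, ho⟩ := hne
      exact ⟨o, hA ho, fun x _ y hy _ => hPW hy⟩
    · obtain ⟨z, hz, hzW⟩ := Finset.not_subset.1 hPW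
      obtain ⟨i, hiW, hmin⟩ := Finset.exists_min_image W (cycDist n z)
        (Finset.card_pos.1 (by omega))
      refine ⟨i, hWP hiW, fun x hx y hy hxy => ?_⟩
      have hins : insert z W = P := by
        apply Finset.eq_of_subset_of_card_le (Finset.insert_subset hz hWP)
        rw [Finset.card_insert_of_notMem hzW]
        omega
      rw [← hins, Finset.mem_insert] at hy
      refine hy.resolve_left ?_
      rintro rfl
      have h1 := hmin x hx
      have hiy : i ≠ y := fun h => hzW (h ▸ hiW)
      have hxy' : x ≠ y := fun h => hzW (h ▸ hx)
      have hi1 := hP (hWP hiW)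
      have hx1 := hP (hWP hx)
      have hy1 := hP hz
      simp only [Finset.mem_Icc, cycDist] at *
      split_ifs at * <;> omega
  obtain ⟨o, ho, hV⟩ := exists_truncSet_eq (n := n) hne i
  refine mem_segFamily.2 ⟨i, hiP, o, ho, hV.symm ▸ hk, ?_⟩
  rw [truncSeg, hV]
  exact (eq_initSeg ((cycDist_injOn (hP hiP)).mono (Finset.coe_subset.2 hP)) hWP hWk hi).symm

end Count

/-! ### Cyclic successors -/

section Succ

variable {n : ℕ} {P : Finset ℕ} {i x : ℕ}

lemma cyclicSucc_mem (hx : x ∈ P) : cyclicSucc P x ∈ P := by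
  unfold cyclicSucc
  split_ifs with h h2
  · exact (Finset.mem_filter.1 (Finset.min'_mem _ h)).1
  · exact Finset.min'_mem _ h2
  · exact absurd ⟨x, hx⟩ h2

lemma cyclicSucc_spec (hP : P ⊆ Finset.Icc 1 n) (hx : x ∈ P) {y : ℕ} (hy : y ∈ P)
    (hyx : y ≠ x) : cyclicSucc P x ≠ x ∧ cycDist n x (cyclicSucc P x) ≤ cycDist n x y := by
  have hs := hP (cyclicSucc_mem hx)
  have hx1 := hP hx
  have hy1 := hP hy
  unfold cyclicSucc at *
  split_ifs at * with h h2
  · have h1 := (Finset.mem_filter.1 (Finset.min'_mem _ h)).2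
    have h3 : x < y → ({y ∈ P | x < y}).min' h ≤ y := fun hxy =>
      Finset.min'_le _ _ (Finset.mem_filter.2 ⟨hy, hxy⟩)
    generalize ({y ∈ P | x < y}).min' h = s at *
    simp only [Finset.mem_Icc, cycDist] at *
    split_ifs <;> omega
  · have h1 : ¬ x < y := fun hxy => h ⟨y, Finset.mem_filter.2 ⟨hy, hxy⟩⟩
    have h3 := Finset.min'_le _ _ hy
    generalize P.min' h2 = s at *
    simp only [Finset.mem_Icc, cycDist] at *
    split_ifs <;> omega
  · exact absurd ⟨x, hx⟩ h2

lemma rankIn_self (hP : P ⊆ Finset.Icc 1 n) (hi : i ∈ P) : rankIn P (cycDist n i) i = 1 := by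
  rw [rankIn, Finset.card_eq_one]
  refine ⟨i, ?_⟩
  ext y
  simp only [Finset.mem_filter, Finset.mem_singleton, cycDist_self, Nat.le_zero]
  constructor
  · rintro ⟨hy, h⟩
    exact cycDist_injOn (hP hi) (hP hy) (hP hi) (by rw [h, cycDist_self])
  · rintro rfl
    exact ⟨hi, cycDist_self _ _⟩

lemma rankIn_cyclicSucc (hP : P ⊆ Finset.Icc 1 n) (hi : i ∈ P) (hx : x ∈ P)
    (h : rankIn P (cycDist n i) x < #P) :
    rankIn P (cycDist n i) (cyclicSucc P x) = rankIn P (cycDist n i) x + 1 := by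
  obtain ⟨z, hz, hxz⟩ : ∃ z ∈ P, cycDist n i x < cycDist n i z := by
    by_contra! hall
    rw [rankIn, Finset.filter_true_of_mem hall] at h
    exact lt_irrefl _ h
  have hi1 := hP hi
  have hx1 := hP hx
  have hz1 := hP hz
  have hs := cyclicSucc_mem hx
  have hs1 := hP hs
  obtain ⟨hsx, hsz⟩ := cyclicSucc_spec hP hx hz (by rintro rfl; exact lt_irrefl _ hxz)
  have hspec := fun y hy hyx => (cyclicSucc_spec (y := y) hP hx hy hyx).2
  generalize cyclicSucc P x = s at *
  have hlt : cycDist n i x < cycDist n i s := by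
    simp only [Finset.mem_Icc, cycDist] at hi1 hx1 hz1 hs1 hxz hsz ⊢
    split_ifs at * <;> omega
  have heq : {y ∈ P | cycDist n i y ≤ cycDist n i s} =
      insert s ({y ∈ P | cycDist n i y ≤ cycDist n i x}) := by
    ext y
    simp only [Finset.mem_filter, Finset.mem_insert]
    constructor
    · rintro ⟨hy, hys⟩
      by_cases hyx : y = x
      · subst hyx
        exact Or.inr ⟨hy, le_rfl⟩
      · have h1 := hspec y hy hyx
        have hy1 := hP hy
        simp only [hy, true_and]
        simp only [Finset.mem_Icc, cycDist] at hi1 hx1 hs1 hy1 hlt hys h1 ⊢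
        split_ifs at * <;> omega
    · rintro (rfl | ⟨hy, hyx⟩)
      · exact ⟨hs, le_rfl⟩
      · exact ⟨hy, by omega⟩
  rw [rankIn, heq, Finset.card_insert_of_notMem, rankIn]
  simp only [Finset.mem_filter, not_and, not_le]
  exact fun _ => hlt

lemma iterate_cyclicSucc_mem (hi : i ∈ P) (j : ℕ) : (cyclicSucc P)^[j] i ∈ P := by
  induction j with
  | zero => exact hi
  | succ j ih =>
    rw [Function.iterate_succ_apply']
    exact cyclicSucc_mem ih

lemma rankIn_iterate (hP : P ⊆ Finset.Icc 1 n) (hi : i ∈ P) {j : ℕ} (hj : j < #P) :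
    rankIn P (cycDist n i) ((cyclicSucc P)^[j] i) = j + 1 := by
  induction j with
  | zero => exact rankIn_self hP hi
  | succ j ih =>
    have ih := ih (by omega)
    rw [Function.iterate_succ_apply',
      rankIn_cyclicSucc hP hi (iterate_cyclicSucc_mem hi j) (by omega), ih]

lemma image_iterate_cyclicSucc (hP : P ⊆ Finset.Icc 1 n) (hi : i ∈ P) {k : ℕ} (hk : k ≤ #P) :
    ((Finset.range k).image fun j => (cyclicSucc P)^[j] i) = initSeg P (cycDist n i) k := by
  apply Finset.eq_of_subset_of_card_le
  · intro x hx
    obtain ⟨j, hj, rfl⟩ := Finset.mem_image.1 hx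
    rw [Finset.mem_range] at hj
    refine Finset.mem_filter.2 ⟨iterate_cyclicSucc_mem hi j, ?_⟩
    rw [rankIn_iterate hP hi (by omega)]
    omega
  · rw [card_initSeg ((cycDist_injOn (hP hi)).mono (Finset.coe_subset.2 hP)), min_eq_left hk,
      Finset.card_image_of_injOn, Finset.card_range]
    intro j hj j' hj' h
    simp only [Finset.coe_range, Set.mem_Iio] at hj hj'
    have h1 := rankIn_iterate hP hi (hj.trans_le hk)
    have h2 := rankIn_iterate hP hi (hj'.trans_le hk)
    dsimp only at h
    rw [h] at h1
    omega

lemma card_image_iterate_eq_iff (hP : P ⊆ Finset.Icc 1 n) (hi : i ∈ P) {k : ℕ} :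
    #((Finset.range k).image fun j => (cyclicSucc P)^[j] i) = k ↔ k ≤ #P := by
  constructor
  · intro h
    rw [← h]
    apply Finset.card_le_card
    intro x hx
    obtain ⟨j, -, rfl⟩ := Finset.mem_image.1 hx
    exact iterate_cyclicSucc_mem hi j
  · intro h
    rw [image_iterate_cyclicSucc hP hi h,
      card_initSeg ((cycDist_injOn (hP hi)).mono (Finset.coe_subset.2 hP)), min_eq_left h]

lemma mem_cyclicIntervalTo (hP : P ⊆ Finset.Icc 1 n) {u v : ℕ} (hu : u ∈ P) (hv : v ∈ P) :
    x ∈ cyclicIntervalTo P u v ↔ x ∈ P ∧ cycDist n u x ≤ cycDist n u v := by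
  have hinj : Set.InjOn (cycDist n u) P := (cycDist_injOn (hP hu)).mono (Finset.coe_subset.2 hP)
  have hv1 := rankIn_pos (g := cycDist n u) hv
  have hvP := rankIn_le_card P (cycDist n u) v
  have hit : (cyclicSucc P)^[rankIn P (cycDist n u) v - 1] u = v := by
    apply rankIn_injOn hinj (iterate_cyclicSucc_mem hu _) hv
    rw [rankIn_iterate hP hu (by omega)]
    omega
  have hex : ∃ m, (cyclicSucc P)^[m] u = v := ⟨_, hit⟩
  classical
  have hfind : Nat.find hex + 1 = rankIn P (cycDist n u) v := by
    have hle := Nat.find_min' hex hit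
    have := rankIn_iterate hP hu (show Nat.find hex < #P by omega)
    rw [Nat.find_spec hex] at this
    exact this.symm
  have heq : cyclicIntervalTo P u v =
      (Finset.range (Nat.find hex + 1)).image fun j => (cyclicSucc P)^[j] u := by
    rw [cyclicIntervalTo, dif_pos hex]
  rw [heq, hfind, image_iterate_cyclicSucc hP hu hvP]
  simp only [initSeg, Finset.mem_filter]
  constructor
  · rintro ⟨hx, h⟩
    exact ⟨hx, (rankIn_le_iff hx).1 h⟩
  · rintro ⟨hx, h⟩
    exact ⟨hx, rankIn_mono h⟩

end Succ

/-! ### Shifts by multiples of `ℓ` -/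

section Shift

variable {n t : ℕ}

lemma shiftMod_mem (hn : 1 ≤ n) (t x : ℕ) : shiftMod n t x ∈ Finset.Icc 1 n := by
  have := Nat.mod_lt (x + t - 1) hn
  simp only [shiftMod, Finset.mem_Icc]
  omega

lemma shiftMod_eq {x : ℕ} (hx : x ∈ Finset.Icc 1 n) (ht : t ≤ n) :
    shiftMod n t x = if x + t ≤ n then x + t else x + t - n := by
  rw [Finset.mem_Icc] at hx
  unfold shiftMod
  split_ifs with h
  · rw [Nat.mod_eq_of_lt (by omega)]
    omega
  · rw [Nat.mod_eq_sub_mod (by omega), Nat.mod_eq_of_lt (by omega)]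
    omega

lemma shiftMod_shiftMod_sub {x : ℕ} (hn : 1 ≤ n) (hx : x ∈ Finset.Icc 1 n) (ht : t ≤ n) :
    shiftMod n t (shiftMod n (n - t) x) = x := by
  rw [shiftMod_eq (shiftMod_mem hn _ _) ht, shiftMod_eq hx (Nat.sub_le _ _)]
  rw [Finset.mem_Icc] at hx
  split_ifs <;> omega

lemma shiftMod_injOn (ht : t ≤ n) :
    Set.InjOn (shiftMod n t) (Finset.Icc 1 n : Finset ℕ) := by
  intro x hx y hy h
  rw [Finset.mem_coe] at hx hy
  rw [shiftMod_eq hx ht, shiftMod_eq hy ht] at h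
  rw [Finset.mem_Icc] at hx hy
  split_ifs at h <;> omega

lemma cycDist_shiftMod {i x : ℕ} (hi : i ∈ Finset.Icc 1 n) (hx : x ∈ Finset.Icc 1 n)
    (ht : t ≤ n) : cycDist n (shiftMod n t i) (shiftMod n t x) = cycDist n i x := by
  rw [shiftMod_eq hi ht, shiftMod_eq hx ht]
  simp only [Finset.mem_Icc, cycDist] at *
  split_ifs <;> omega

lemma shiftSet_truncSeg {k : ℕ} {P A : Finset ℕ} {i o : ℕ} (hP : P ⊆ Finset.Icc 1 n)
    (ht : t ≤ n) (hi : i ∈ P) (ho : o ∈ P)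
    (hPt : ∀ x ∈ Finset.Icc 1 n, shiftMod n t x ∈ P ↔ x ∈ P)
    (hAt : ∀ x ∈ Finset.Icc 1 n, shiftMod n t x ∈ A ↔ x ∈ A) :
    #(truncSet n P A (shiftMod n t i) (shiftMod n t o)) = #(truncSet n P A i o) ∧
    shiftSet n t (truncSeg n k P A i o) =
      truncSeg n k P A (shiftMod n t i) (shiftMod n t o) := by
  have hV : truncSet n P A (shiftMod n t i) (shiftMod n t o) =
      (truncSet n P A i o).image (shiftMod n t) := by
    ext y
    simp only [truncSet, Finset.mem_filter, Finset.mem_image]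
    constructor
    · rintro ⟨hy, h⟩
      have hy1 := hP hy
      have hn : 1 ≤ n := by
        rw [Finset.mem_Icc] at hy1
        omega
      have hyx := shiftMod_shiftMod_sub hn hy1 ht
      have hx := shiftMod_mem hn (n - t) y
      generalize shiftMod n (n - t) y = x at *
      subst hyx
      rw [hAt x hx, cycDist_shiftMod (hP hi) hx ht, cycDist_shiftMod (hP hi) (hP ho) ht] at h
      exact ⟨x, ⟨(hPt x hx).1 hy, h⟩, rfl⟩
    · rintro ⟨x, ⟨hx, h⟩, rfl⟩
      rw [hAt x (hP hx), cycDist_shiftMod (hP hi) (hP hx) ht,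
        cycDist_shiftMod (hP hi) (hP ho) ht]
      exact ⟨(hPt x (hP hx)).2 hx, h⟩
  have hinj : Set.InjOn (shiftMod n t) (truncSet n P A i o) :=
    (shiftMod_injOn ht).mono (Finset.coe_subset.2 ((truncSet_subset _ _ _ _ _).trans hP))
  refine ⟨by rw [hV, Finset.card_image_of_injOn hinj], ?_⟩
  rw [truncSeg, truncSeg, hV, shiftSet]
  exact image_initSeg k hinj fun x hx =>
    cycDist_shiftMod (hP hi) (hP (truncSet_subset _ _ _ _ _ hx)) ht

end Shift

/-! ### The output collection -/

section Output

variable {d ℓ : ℕ} {a : ℕ → ℕ}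

lemma mem_orbit {b x : ℕ} (hb1 : 1 ≤ b) (hb : b ≤ ℓ) :
    x ∈ orbit d ℓ b ↔ x ∈ Finset.Icc 1 (d * ℓ) ∧ (x - 1) % ℓ + 1 = b := by
  simp only [orbit, Finset.mem_image, Finset.mem_range, Finset.mem_Icc]
  constructor
  · rintro ⟨j, hj, rfl⟩
    have h1 : (j + 1) * ℓ ≤ d * ℓ := Nat.mul_le_mul_right _ hj
    rw [Nat.add_mul, Nat.one_mul] at h1
    refine ⟨⟨by omega, by omega⟩, ?_⟩
    rw [show b + j * ℓ - 1 = b - 1 + j * ℓ by omega, Nat.add_mul_mod_self_right,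
      Nat.mod_eq_of_lt (by omega)]
    omega
  · rintro ⟨⟨h1, h2⟩, rfl⟩
    refine ⟨(x - 1) / ℓ, Nat.div_lt_of_lt_mul (by rw [mul_comm]; omega), ?_⟩
    have := Nat.mod_add_div (x - 1) ℓ
    rw [mul_comm] at this
    omega

lemma card_orbit (hl : 1 ≤ ℓ) (b : ℕ) : #(orbit d ℓ b) = d := by
  rw [orbit, Finset.card_image_of_injective, Finset.card_range]
  intro i j h
  exact Nat.eq_of_mul_eq_mul_right hl (Nat.add_left_cancel h)

lemma mem_Pset {s x : ℕ} : x ∈ Pset d ℓ a s ↔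
    x ∈ Finset.Icc 1 (d * ℓ) ∧ ∀ j ∈ Finset.Icc 1 (s - 1), x ∉ orbit d ℓ (a j) := by
  simp [Pset]

lemma Pset_subset (s : ℕ) : Pset d ℓ a s ⊆ Finset.Icc 1 (d * ℓ) := Finset.sdiff_subset

lemma Pset_one : Pset d ℓ a 1 = Finset.Icc 1 (d * ℓ) := by
  simp [Pset]

lemma Pset_succ {s : ℕ} (hs : 1 ≤ s) :
    Pset d ℓ a (s + 1) = Pset d ℓ a s \ orbit d ℓ (a s) := by
  ext x
  simp only [Finset.mem_sdiff, mem_Pset, Finset.mem_Icc]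
  constructor
  · rintro ⟨h1, h2⟩
    exact ⟨⟨h1, fun j hj => h2 j (by omega)⟩, h2 s (by omega)⟩
  · rintro ⟨⟨h1, h2⟩, h3⟩
    refine ⟨h1, fun j hj => ?_⟩
    rcases eq_or_ne j s with rfl | hjs
    · exact h3
    · exact h2 j (by omega)

lemma Pset_anti {s t : ℕ} (h : s ≤ t) : Pset d ℓ a t ⊆ Pset d ℓ a s := by
  intro x hx
  rw [mem_Pset] at hx ⊢
  refine ⟨hx.1, fun j hj => hx.2 j ?_⟩
  rw [Finset.mem_Icc] at hj ⊢
  omega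

lemma orbit_subset_Pset (ha : Set.BijOn a (Set.Icc 1 ℓ) (Set.Icc 1 ℓ)) {s : ℕ} (hs1 : 1 ≤ s)
    (hs : s ≤ ℓ) : orbit d ℓ (a s) ⊆ Pset d ℓ a s := by
  intro x hx
  have has := ha.mapsTo ⟨hs1, hs⟩
  rw [mem_orbit has.1 has.2] at hx
  refine mem_Pset.2 ⟨hx.1, fun j hj hxj => ?_⟩
  rw [Finset.mem_Icc] at hj
  have hj' : j ∈ Set.Icc 1 ℓ := ⟨by omega, by omega⟩
  have haj := ha.mapsTo hj'
  rw [mem_orbit haj.1 haj.2] at hxj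
  have := ha.injOn hj' ⟨hs1, hs⟩ (hxj.2.symm.trans hx.2)
  omega

lemma card_Pset (ha : Set.BijOn a (Set.Icc 1 ℓ) (Set.Icc 1 ℓ)) {m : ℕ} (hm : m ≤ ℓ) :
    #(Pset d ℓ a (m + 1)) + d * m = d * ℓ := by
  induction m with
  | zero => simp [Pset_one]
  | succ m ih =>
    have hsub := orbit_subset_Pset (d := d) ha (Nat.le_add_left 1 m) hm
    have hc := Finset.card_le_card hsub
    rw [Pset_succ (Nat.le_add_left 1 m), Finset.card_sdiff_of_subset hsub]
    rw [card_orbit (by omega)] at hc ⊢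
    have := ih (by omega)
    rw [Nat.mul_add, Nat.mul_one]
    omega

lemma shiftMod_mem_orbit {b x j : ℕ} (hb1 : 1 ≤ b) (hb : b ≤ ℓ)
    (hx : x ∈ Finset.Icc 1 (d * ℓ)) :
    shiftMod (d * ℓ) (j * ℓ) x ∈ orbit d ℓ b ↔ x ∈ orbit d ℓ b := by
  have hn : 1 ≤ d * ℓ := by
    rw [Finset.mem_Icc] at hx
    omega
  have hmod : (shiftMod (d * ℓ) (j * ℓ) x - 1) % ℓ = (x - 1) % ℓ := by
    rw [Finset.mem_Icc] at hx
    rw [shiftMod, Nat.add_sub_cancel, Nat.mod_mul_left_mod,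
      show x + j * ℓ - 1 = x - 1 + j * ℓ by omega, Nat.add_mul_mod_self_right]
  rw [mem_orbit hb1 hb, mem_orbit hb1 hb, hmod]
  simp only [hx, shiftMod_mem hn]

lemma shiftMod_mem_Pset (ha : Set.BijOn a (Set.Icc 1 ℓ) (Set.Icc 1 ℓ)) {s j x : ℕ}
    (hs : s ≤ ℓ + 1) (hx : x ∈ Finset.Icc 1 (d * ℓ)) :
    shiftMod (d * ℓ) (j * ℓ) x ∈ Pset d ℓ a s ↔ x ∈ Pset d ℓ a s := by
  have hn : 1 ≤ d * ℓ := by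
    rw [Finset.mem_Icc] at hx
    omega
  simp only [mem_Pset, hx, shiftMod_mem hn, true_and]
  refine forall₂_congr fun i hi => ?_
  rw [Finset.mem_Icc] at hi
  have hai := ha.mapsTo (show i ∈ Set.Icc 1 ℓ from ⟨by omega, by omega⟩)
  rw [shiftMod_mem_orbit hai.1 hai.2 hx]

lemma add_mul_le {b j : ℕ} (hb : b ≤ ℓ) (hj : j < d) : b + j * ℓ ≤ d * ℓ := by
  have h1 : (j + 1) * ℓ ≤ d * ℓ := Nat.mul_le_mul_right _ hj
  rw [Nat.add_mul, Nat.one_mul] at h1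
  omega

/-- Starting less than `ℓ` steps before `a s`, the elements of the orbit of `a s` are met in their
natural order. -/
lemma Psh_eq_truncSet {s h i : ℕ} (has1 : 1 ≤ a s) (has : a s ≤ ℓ) (hh1 : 1 ≤ h) (hh : h ≤ d)
    (hi : i ∈ Finset.Icc 1 (d * ℓ)) (hia : cycDist (d * ℓ) i (a s) < ℓ) :
    Psh d ℓ a s h =
      truncSet (d * ℓ) (Pset d ℓ a s) (orbit d ℓ (a s)) i (a s + (h - 1) * ℓ) := by
  have hcd : ∀ j < d, cycDist (d * ℓ) i (a s + j * ℓ) = cycDist (d * ℓ) i (a s) + j * ℓ := by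
    intro j hj
    have h1 := add_mul_le (b := ℓ) le_rfl hj
    rw [Finset.mem_Icc] at hi
    simp only [cycDist] at hia ⊢
    split_ifs at * <;> omega
  have hsh : ∀ j < d, shiftMod (d * ℓ) (j * ℓ) (a s) = a s + j * ℓ := by
    intro j hj
    have h1 := add_mul_le has hj
    rw [shiftMod_eq (Finset.mem_Icc.2 ⟨has1, by omega⟩) (by omega), if_pos h1]
  ext x
  simp only [Psh, truncSet, Finset.mem_sdiff, Finset.mem_filter, Finset.mem_image, Finset.mem_Ico,
    not_exists, not_and, orbit, Finset.mem_range]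
  refine and_congr_right fun hx => ?_
  constructor
  · intro hx'
    by_cases hxA : ∃ j < d, a s + j * ℓ = x
    · right
      obtain ⟨j, hj, rfl⟩ := hxA
      have hjh : ¬ h ≤ j := fun hjh => hx' j ⟨hjh, hj⟩ (hsh j hj)
      rw [hcd j hj, hcd (h - 1) (by omega)]
      exact Nat.add_le_add_left (Nat.mul_le_mul_right _ (by omega)) _
    · left
      push Not at hxA
      exact hxA
  · rintro hx' j ⟨hhj, hj⟩ rfl
    rw [hsh j hj] at hx'
    rcases hx' with hx' | hx'
    · exact hx' j hj rfl
    · rw [hcd j hj, hcd (h - 1) (by omega)] at hx'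
      have := Nat.le_of_mul_le_mul_right (Nat.le_of_add_le_add_left hx') (by omega : 0 < ℓ)
      omega

lemma mem_interval_iff (hd : 1 ≤ d) (ha : Set.BijOn a (Set.Icc 1 ℓ) (Set.Icc 1 ℓ)) {s i : ℕ}
    (hs1 : 1 ≤ s) (hs : s ≤ ℓ) :
    i ∈ cyclicIntervalTo (Pset d ℓ a s)
        (cyclicSucc (Pset d ℓ a s) (shiftMod (d * ℓ) (d * ℓ - ℓ) (a s))) (a s) ↔
      i ∈ Pset d ℓ a s ∧ cycDist (d * ℓ) i (a s) < ℓ := by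
  have has := ha.mapsTo (show s ∈ Set.Icc 1 ℓ from ⟨hs1, hs⟩)
  have hln : ℓ ≤ d * ℓ := Nat.le_mul_of_pos_left _ hd
  have hP := Pset_subset (d := d) (ℓ := ℓ) (a := a) s
  have hv : a s ∈ Pset d ℓ a s := by
    apply orbit_subset_Pset ha hs1 hs
    exact Finset.mem_image.2 ⟨0, Finset.mem_range.2 hd, by simp⟩
  have hw : shiftMod (d * ℓ) (d * ℓ - ℓ) (a s) ∈ Pset d ℓ a s := by
    have := (shiftMod_mem_Pset (j := d - 1) ha (by omega : s ≤ ℓ + 1) (hP hv)).2 hv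
    rwa [Nat.sub_mul, Nat.one_mul] at this
  have hweq := shiftMod_eq (hP hv) (Nat.sub_le (d * ℓ) ℓ)
  have hu := cyclicSucc_mem hw
  rw [mem_cyclicIntervalTo hP hu hv]
  refine and_congr_right fun hi => ?_
  have hspec := fun y hy => cyclicSucc_spec (y := y) hP hw hy
  have hsi := hspec i hi
  have hsv := hspec (a s) hv
  have hi1 := hP hi
  have hv1 := hP hv
  have hw1 := hP hw
  have hu1 := hP hu
  clear hspec
  generalize cyclicSucc (Pset d ℓ a s) (shiftMod (d * ℓ) (d * ℓ - ℓ) (a s)) = u at *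
  generalize shiftMod (d * ℓ) (d * ℓ - ℓ) (a s) = w at *
  generalize a s = v at *
  generalize d * ℓ = n at *
  simp only [Finset.mem_Icc, Set.mem_Icc, cycDist] at *
  split_ifs at * <;> omega

lemma mem_Bset (hd : 1 ≤ d) (ha : Set.BijOn a (Set.Icc 1 ℓ) (Set.Icc 1 ℓ)) {k s : ℕ}
    (hs1 : 1 ≤ s) (hs : s ≤ ℓ) {W : Finset ℕ} :
    W ∈ Bset d ℓ k a s ↔ ∃ i ∈ Pset d ℓ a s, cycDist (d * ℓ) i (a s) < ℓ ∧ ∃ j < d,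
      k ≤ #(truncSet (d * ℓ) (Pset d ℓ a s) (orbit d ℓ (a s)) i (a s + j * ℓ)) ∧
      truncSeg (d * ℓ) k (Pset d ℓ a s) (orbit d ℓ (a s)) i (a s + j * ℓ) = W := by
  have has := ha.mapsTo (show s ∈ Set.Icc 1 ℓ from ⟨hs1, hs⟩)
  have hP := Pset_subset (d := d) (ℓ := ℓ) (a := a) s
  have key : ∀ i ∈ Pset d ℓ a s, cycDist (d * ℓ) i (a s) < ℓ → ∀ h, 1 ≤ h → h ≤ d →
      ((Iih d ℓ k a s h i = W ∧ #W = k) ↔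
      k ≤ #(truncSet (d * ℓ) (Pset d ℓ a s) (orbit d ℓ (a s)) i (a s + (h - 1) * ℓ)) ∧
      truncSeg (d * ℓ) k (Pset d ℓ a s) (orbit d ℓ (a s)) i (a s + (h - 1) * ℓ) = W) := by
    intro i hi hia h hh1 hh
    have heq := Psh_eq_truncSet has.1 has.2 hh1 hh (hP hi) hia
    have hV := (truncSet_subset (d * ℓ) (Pset d ℓ a s) (orbit d ℓ (a s)) i
      (a s + (h - 1) * ℓ)).trans hP
    have hiV := mem_truncSet_left (n := d * ℓ) (A := orbit d ℓ (a s)) (o := a s + (h - 1) * ℓ) hi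
    rw [Iih, heq]
    constructor
    · rintro ⟨rfl, h2⟩
      have h3 := (card_image_iterate_eq_iff hV hiV).1 h2
      exact ⟨h3, (image_iterate_cyclicSucc hV hiV h3).symm⟩
    · rintro ⟨h1, rfl⟩
      exact ⟨image_iterate_cyclicSucc hV hiV h1, card_truncSeg hP hi h1⟩
  simp only [Bset, Finset.mem_filter, Finset.mem_image, Finset.mem_product, Prod.exists,
    mem_interval_iff hd ha hs1 hs, Finset.mem_Icc]
  constructor
  · rintro ⟨⟨i, h, ⟨⟨hi, hia⟩, hh1, hh⟩, hW⟩, hc⟩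
    exact ⟨i, hi, hia, h - 1, by omega, (key i hi hia h hh1 hh).1 ⟨hW, hc⟩⟩
  · rintro ⟨i, hi, hia, j, hj, hW⟩
    obtain ⟨h1, h2⟩ := (key i hi hia (j + 1) (by omega) (by omega)).2 (by simpa using hW)
    exact ⟨⟨i, j + 1, ⟨⟨hi, hia⟩, by omega, by omega⟩, h1⟩, h2⟩

/-- Every element of `[dℓ]` is a shift of one lying less than `ℓ` steps before `b`. -/
lemma exists_shiftMod_eq {b i : ℕ} (hb1 : 1 ≤ b) (hb : b ≤ ℓ) (hi : i ∈ Finset.Icc 1 (d * ℓ)) :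
    ∃ i₀ ∈ Finset.Icc 1 (d * ℓ), cycDist (d * ℓ) i₀ b < ℓ ∧
      ∃ j, 1 ≤ j ∧ j ≤ d ∧ shiftMod (d * ℓ) (j * ℓ) i₀ = i := by
  rw [Finset.mem_Icc] at hi
  have hρ := Nat.mod_lt (i - 1) (by omega : 0 < ℓ)
  have hdiv := Nat.mod_add_div (i - 1) ℓ
  have hq : (i - 1) / ℓ < d := Nat.div_lt_of_lt_mul (by rw [mul_comm]; omega)
  rw [mul_comm] at hdiv
  generalize (i - 1) % ℓ = ρ at *
  generalize (i - 1) / ℓ = q at *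
  have hqn := add_mul_le (b := ℓ) le_rfl hq
  by_cases hle : ρ + 1 ≤ b
  · have hm : ρ + 1 ∈ Finset.Icc 1 (d * ℓ) := Finset.mem_Icc.2 ⟨by omega, by omega⟩
    refine ⟨ρ + 1, hm, ?_, ?_⟩
    · rw [cycDist, if_pos hle]
      omega
    · rcases Nat.eq_zero_or_pos q with rfl | hq0
      · refine ⟨d, by omega, le_rfl, ?_⟩
        rw [shiftMod_eq hm le_rfl]
        split_ifs <;> omega
      · refine ⟨q, hq0, hq.le, ?_⟩
        rw [shiftMod_eq hm (by omega)]
        split_ifs <;> omega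
  · have hm : ρ + 1 + d * ℓ - ℓ ∈ Finset.Icc 1 (d * ℓ) := Finset.mem_Icc.2 ⟨by omega, by omega⟩
    refine ⟨_, hm, ?_, q + 1, by omega, hq, ?_⟩
    · rw [cycDist]
      split_ifs <;> omega
    · rw [Nat.add_mul, Nat.one_mul, shiftMod_eq hm (by omega)]
      split_ifs <;> omega

lemma Lset_eq_segFamily (hd : 1 ≤ d) (ha : Set.BijOn a (Set.Icc 1 ℓ) (Set.Icc 1 ℓ)) {k s : ℕ}
    (hs1 : 1 ≤ s) (hs : s ≤ ℓ) :
    Lset d ℓ k a s = segFamily (d * ℓ) k (Pset d ℓ a s) (orbit d ℓ (a s)) := by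
  have has := ha.mapsTo (show s ∈ Set.Icc 1 ℓ from ⟨hs1, hs⟩)
  have hP := Pset_subset (d := d) (ℓ := ℓ) (a := a) s
  have hA := orbit_subset_Pset (d := d) ha hs1 hs
  have hPt := fun j x => shiftMod_mem_Pset (d := d) (j := j) (x := x) ha (by omega : s ≤ ℓ + 1)
  have hAt := fun j x => shiftMod_mem_orbit (d := d) (j := j) (x := x) has.1 has.2
  have hmem : ∀ j < d, a s + j * ℓ ∈ orbit d ℓ (a s) := fun j hj =>
    Finset.mem_image.2 ⟨j, Finset.mem_range.2 hj, rfl⟩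
  have hn : 1 ≤ d * ℓ := Nat.mul_pos hd (hs1.trans hs)
  ext W
  simp only [Lset, Finset.mem_image, Finset.mem_product, Prod.exists, mem_Bset hd ha hs1 hs,
    mem_segFamily, Finset.mem_Icc]
  constructor
  · rintro ⟨_, x, ⟨⟨i, hi, -, j, hj, hV, rfl⟩, hx1, hx⟩, rfl⟩
    have ho := hA (hmem j hj)
    obtain ⟨h1, h2⟩ := shiftSet_truncSeg (k := k) hP (Nat.mul_le_mul_right ℓ hx) hi ho
      (hPt x) (hAt x)
    exact ⟨_, (hPt x i (hP hi)).2 hi, _, (hAt x _ (hP ho)).2 (hmem j hj), h1.symm ▸ hV, h2.symm⟩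
  · rintro ⟨i, hi, o, ho, hV, rfl⟩
    obtain ⟨i₀, hi₀, hia, x, hx1, hx, rfl⟩ := exists_shiftMod_eq has.1 has.2 (hP hi)
    have hxn : x * ℓ ≤ d * ℓ := Nat.mul_le_mul_right ℓ hx
    have ho1 := hP (hA ho)
    obtain ⟨o₀, ho₀, rfl⟩ : ∃ o₀ ∈ Finset.Icc 1 (d * ℓ), shiftMod (d * ℓ) (x * ℓ) o₀ = o :=
      ⟨_, shiftMod_mem hn _ _, shiftMod_shiftMod_sub hn ho1 hxn⟩
    have hi₀P := (hPt x i₀ hi₀).1 hi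
    have ho₀A := (hAt x o₀ ho₀).1 ho
    obtain ⟨h1, h2⟩ := shiftSet_truncSeg (k := k) hP hxn hi₀P (hA ho₀A) (hPt x) (hAt x)
    obtain ⟨j, hj, rfl⟩ := Finset.mem_image.1 ho₀A
    exact ⟨_, x, ⟨⟨i₀, hi₀P, hia, j, Finset.mem_range.1 hj, h1 ▸ hV, rfl⟩, hx1, hx⟩, h2⟩

lemma card_Dcol (hd : 1 ≤ d) (ha : Set.BijOn a (Set.Icc 1 ℓ) (Set.Icc 1 ℓ)) {k r : ℕ}
    (hk1 : 1 ≤ k) (hr1 : 1 ≤ r) (hr : r ≤ ℓ) :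
    #(Dcol d ℓ k r a) = ∑ s ∈ Finset.Icc 1 (ℓ - r),
      #(meetFamily (d * ℓ) k (Pset d ℓ a s) (orbit d ℓ (a s))) +
      #(segFamily (d * ℓ) k (Pset d ℓ a (ℓ - r + 1)) (orbit d ℓ (a (ℓ - r + 1)))) := by
  set N := ℓ - r with hN
  have hNl : N + 1 ≤ ℓ := by omega
  have hn : ∀ s, (orbit d ℓ (a s)).Nonempty := fun s =>
    Finset.card_pos.1 (by rw [card_orbit (by omega)]; omega)
  have hstep : ∀ j s W, 1 ≤ s → s + j = N + 1 →
      W ∈ segFamily (d * ℓ) k (Pset d ℓ a s) (orbit d ℓ (a s)) →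
      W ∈ ((Finset.Icc 1 N).biUnion fun s =>
        meetFamily (d * ℓ) k (Pset d ℓ a s) (orbit d ℓ (a s))) ∪
        segFamily (d * ℓ) k (Pset d ℓ a (N + 1)) (orbit d ℓ (a (N + 1))) := by
    intro j
    induction j with
    | zero =>
      rintro s W - rfl hW
      exact Finset.mem_union_right _ hW
    | succ j ih =>
      intro s W hs1 hs hW
      by_cases hne : (W ∩ orbit d ℓ (a s)).Nonempty
      · exact Finset.mem_union_left _ (Finset.mem_biUnion.2
          ⟨s, Finset.mem_Icc.2 ⟨hs1, by omega⟩, Finset.mem_filter.2 ⟨hW, hne⟩⟩)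
      · refine ih (s + 1) W (by omega) (by omega) ?_
        rw [Pset_succ hs1]
        exact mem_segFamily_sdiff (Pset_subset s) (hn _) hk1 hW hne
  have heq : Dcol d ℓ k r a = ((Finset.Icc 1 N).biUnion fun s =>
        meetFamily (d * ℓ) k (Pset d ℓ a s) (orbit d ℓ (a s))) ∪
        segFamily (d * ℓ) k (Pset d ℓ a (N + 1)) (orbit d ℓ (a (N + 1))) := by
    apply Finset.Subset.antisymm
    · intro W hW
      obtain ⟨s, hs, hW⟩ := Finset.mem_biUnion.1 hW
      rw [Finset.mem_Icc] at hs
      rw [Lset_eq_segFamily hd ha hs.1 (by omega)] at hW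
      exact hstep (N + 1 - s) s W hs.1 (by omega) hW
    · intro W hW
      rcases Finset.mem_union.1 hW with hW | hW
      · obtain ⟨s, hs, hW⟩ := Finset.mem_biUnion.1 hW
        rw [Finset.mem_Icc] at hs
        refine Finset.mem_biUnion.2 ⟨s, Finset.mem_Icc.2 ⟨hs.1, by omega⟩, ?_⟩
        rw [Lset_eq_segFamily hd ha hs.1 (by omega)]
        exact (Finset.mem_filter.1 hW).1
      · refine Finset.mem_biUnion.2 ⟨N + 1, Finset.mem_Icc.2 ⟨by omega, le_rfl⟩, ?_⟩
        rwa [Lset_eq_segFamily hd ha (by omega) (by omega)]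
  have hdisj : ∀ s t W, 1 ≤ s → s < t → (W ∩ orbit d ℓ (a s)).Nonempty →
      W ∉ segFamily (d * ℓ) k (Pset d ℓ a t) (orbit d ℓ (a t)) := by
    rintro s t W hs1 hst ⟨x, hx⟩ hW
    rw [Finset.mem_inter] at hx
    have hxs := Pset_anti (Nat.succ_le_of_lt hst) (subset_of_mem_segFamily hW hx.1)
    rw [Nat.succ_eq_add_one, Pset_succ hs1] at hxs
    exact (Finset.mem_sdiff.1 hxs).2 hx.2
  rw [heq, Finset.card_union_of_disjoint, Finset.card_biUnion]
  · intro s hs t ht hst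
    rw [Finset.mem_coe, Finset.mem_Icc] at hs ht
    rw [Function.onFun, Finset.disjoint_left]
    intro W hW hW'
    rw [meetFamily, Finset.mem_filter] at hW hW'
    rcases lt_or_gt_of_ne hst with h | h
    · exact hdisj s t W hs.1 h hW.2 hW'.1
    · exact hdisj t s W ht.1 h hW'.2 hW.1
  · rw [Finset.disjoint_left]
    intro W hW hW'
    obtain ⟨s, hs, hW⟩ := Finset.mem_biUnion.1 hW
    rw [Finset.mem_Icc] at hs
    exact hdisj s (N + 1) W hs.1 (by omega) (Finset.mem_filter.1 hW).2 hW'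

/-- For `k = 1` and `r = 0` the output collection consists of all singletons. -/
lemma card_Dcol_one_zero (hd : 1 ≤ d) (hl : 1 ≤ ℓ)
    (ha : Set.BijOn a (Set.Icc 1 ℓ) (Set.Icc 1 ℓ)) : #(Dcol d ℓ 1 0 a) = d * ℓ := by
  have hn : 1 ≤ d * ℓ := Nat.mul_pos hd hl
  have heq : Dcol d ℓ 1 0 a = (Finset.Icc 1 (d * ℓ)).powersetCard 1 := by
    ext W
    rw [Finset.mem_powersetCard]
    constructor
    · intro hW
      obtain ⟨s, -, hW⟩ := Finset.mem_biUnion.1 hW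
      obtain ⟨⟨I, x⟩, hI, rfl⟩ := Finset.mem_image.1 hW
      have hI1 : #I = 1 := (Finset.mem_filter.1 (Finset.mem_product.1 hI).1).2
      obtain ⟨y, rfl⟩ := Finset.card_eq_one.1 hI1
      simp only [shiftSet, Finset.image_singleton, Finset.singleton_subset_iff,
        Finset.card_singleton, and_true]
      exact shiftMod_mem hn _ _
    · rintro ⟨hW, hW1⟩
      obtain ⟨x, rfl⟩ := Finset.card_eq_one.1 hW1
      rw [Finset.singleton_subset_iff, ← Pset_one (a := a)] at hW
      refine Finset.mem_biUnion.2 ⟨1, Finset.mem_Icc.2 ⟨le_rfl, by omega⟩, ?_⟩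
      rw [Lset_eq_segFamily hd ha le_rfl hl]
      have ho : a 1 ∈ orbit d ℓ (a 1) := Finset.mem_image.2 ⟨0, Finset.mem_range.2 hd, by simp⟩
      have hV : 1 ≤ #(truncSet (d * ℓ) (Pset d ℓ a 1) (orbit d ℓ (a 1)) x (a 1)) :=
        Finset.card_pos.2 ⟨x, mem_truncSet_left hW⟩
      refine mem_segFamily.2 ⟨x, hW, a 1, ho, hV, ?_⟩
      refine (Finset.eq_of_subset_of_card_le (Finset.singleton_subset_iff.2
        (mem_truncSeg_left (Pset_subset 1) hW le_rfl hV)) ?_).symm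
      rw [card_truncSeg (Pset_subset 1) hW hV, Finset.card_singleton]
  rw [heq, Finset.card_powersetCard]
  simp

end Output

/-- With the algorithm setup (`n = dℓ`, `k = dr + c`, `c ∈ {−1,0,1}`):
the output collection `D = L_1 ∪ … ∪ L_{ℓ−r+1}` has exactly `k(dℓ − k) + 1` elements. -/
theorem stmt9 (d ℓ k : ℕ) (hd : 1 ≤ d) (hl : 1 ≤ ℓ) (hk1 : 1 ≤ k) (hk2 : 2 * k ≤ d * ℓ)
    (a : ℕ → ℕ) (ha : Set.BijOn a (Set.Icc 1 ℓ) (Set.Icc 1 ℓ))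
    (r : ℕ) (c : ℤ) (hc : c = -1 ∨ c = 0 ∨ c = 1) (hk : (k : ℤ) = d * r + c) :
    (Dcol d ℓ k r a).card = k * (d * ℓ - k) + 1 := by
  rcases Nat.eq_zero_or_pos r with rfl | hr1
  · obtain rfl : k = 1 := by
      push_cast at hk
      omega
    rw [card_Dcol_one_zero hd hl ha]
    omega
  have hrl : r ≤ ℓ := by
    by_contra! h
    have h1 : d * (ℓ + 1) ≤ d * r := Nat.mul_le_mul_left d h
    rw [Nat.mul_add, Nat.mul_one] at h1
    omega
  obtain ⟨N, rfl⟩ := Nat.exists_eq_add_of_le' hrl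
  rw [card_Dcol hd ha hk1 hr1 hrl, Nat.add_sub_cancel]
  have hP := fun s => Pset_subset (d := d) (ℓ := N + r) (a := a) s
  have hcard : ∀ m ≤ N, #(Pset d (N + r) a (m + 1)) + d * m = d * N + d * r := by
    intro m hm
    rw [card_Pset ha (by omega), Nat.mul_add]
  have hA : ∀ s, 1 ≤ s → s ≤ N + 1 → orbit d (N + r) (a s) ⊆ Pset d (N + r) a s :=
    fun s hs1 hs => orbit_subset_Pset ha hs1 (by omega)
  have hne : ∀ s, (orbit d (N + r) (a s)).Nonempty := fun s =>
    Finset.card_pos.1 (by rw [card_orbit hl]; omega)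
  have hlast := hcard N le_rfl
  have hgen : ∀ s, 1 ≤ s → s ≤ N → k + d * s ≤ d * N + d * r →
      #(meetFamily (d * (N + r)) k (Pset d (N + r) a s) (orbit d (N + r) (a s))) = k * d := by
    intro s hs1 hs h
    rw [card_meetFamily (hP s) (hA s hs1 (by omega)) hk1, card_orbit hl]
    rw [← Pset_succ hs1]
    have := hcard s hs
    omega
  have hsum : ∀ M ≤ N, k + d * M ≤ d * N + d * r →
      ∑ s ∈ Finset.Icc 1 M,
        #(meetFamily (d * (N + r)) k (Pset d (N + r) a s) (orbit d (N + r) (a s))) =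
      M * (k * d) := by
    intro M hM h
    rw [Finset.sum_congr rfl (g := fun _ => k * d), Finset.sum_const, Nat.card_Icc,
      Nat.add_sub_cancel, smul_eq_mul]
    intro s hs
    rw [Finset.mem_Icc] at hs
    have := Nat.mul_le_mul_left d hs.2
    exact hgen s hs.1 (by omega) (by omega)
  rcases hc with rfl | rfl | rfl
  · have hk' : k + 1 = d * r := by
      zify
      omega
    rw [hsum N le_rfl (by omega),
      segFamily_eq_powersetCard (hP _) (hA _ (by omega) le_rfl) (hne _) hk1 (by omega) (by omega),
      Finset.card_powersetCard, show #(Pset d (N + r) a (N + 1)) = k + 1 by omega,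
      Nat.choose_succ_self_right, Nat.mul_add, ← hk',
      show d * N + (k + 1) - k = d * N + 1 by omega]
    ring
  · have hk' : k = d * r := by
      zify
      omega
    rw [hsum N le_rfl (by omega),
      segFamily_eq_powersetCard (hP _) (hA _ (by omega) le_rfl) (hne _) hk1 (by omega) (by omega),
      Finset.card_powersetCard, show #(Pset d (N + r) a (N + 1)) = k by omega,
      Nat.choose_self, Nat.mul_add, ← hk', Nat.add_sub_cancel]
    ring
  · have hk' : k = d * r + 1 := by
      zify
      omega
    obtain ⟨M, rfl⟩ : ∃ M, N = M + 1 := by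
      refine Nat.exists_eq_add_one_of_ne_zero ?_
      rintro rfl
      rw [Nat.zero_add] at hk2
      omega
    have hM := hcard (M + 1) le_rfl
    rw [segFamily_eq_empty (by omega), Finset.card_empty, Finset.sum_Icc_succ_top (by omega),
      hsum M (by omega) (by rw [Nat.mul_add, Nat.mul_one]; omega),
      card_meetFamily_of_eq (hP _) (hA _ (by omega) (by omega)) (hne _)
        (by rw [← Pset_succ (by omega)]; omega),
      card_orbit hl, ← Pset_succ (by omega), Nat.mul_add d (M + 1) r,
      show #(Pset d (M + 1 + r) a (M + 1 + 1)) = d * r by omega]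
    have hle : d * r ≤ k * d := by nlinarith
    have hsub : d * (M + 1) + d * r - k = d * M + (d - 1) := by
      rw [Nat.mul_add, Nat.mul_one]
      omega
    rw [hsub]
    zify [hle, hd]
    subst hk'
    push_cast
    ring
end

section
/- With the algorithm setup (n = dℓ, k = dr + c, c ∈ {−1,0,1}): for every 1 ≤ s ≤ ℓ − r + 1, the collection L_s is weakly separated. -/
open Finset

/-- The cyclic distance from `i` to `y`, going upwards in `[n]`. -/
def cyclicPos (n i y : ℕ) : ℕ := if i ≤ y then y - i else y + n - i

theorem cyclicPos_spec {n i : ℕ} (y : ℕ) (hi : i ≤ n) :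
    (i ≤ y ∧ cyclicPos n i y + i = y) ∨ (y < i ∧ cyclicPos n i y + i = y + n) := by
  unfold cyclicPos
  split_ifs <;> omega

theorem cyclicPos_inj {n i y z : ℕ} (hi : i ≤ n) (hy : 1 ≤ y ∧ y ≤ n) (hz : 1 ≤ z ∧ z ≤ n)
    (h : cyclicPos n i y = cyclicPos n i z) : y = z := by
  have h1 := cyclicPos_spec y hi
  have h2 := cyclicPos_spec z hi
  omega

theorem not_alternating_of_cyclicPos {n i j a b c d : ℕ} (h : a < b ∧ b < c ∧ c < d)
    (hi : 1 ≤ i ∧ i ≤ n) (hj : 1 ≤ j ∧ j ≤ n) (ha : 1 ≤ a) (hd : d ≤ n) {E E' H H' : ℕ}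
    (ha1 : cyclicPos n i a < E) (hc1 : cyclicPos n i c < E)
    (hb1 : cyclicPos n j b < E') (hd1 : cyclicPos n j d < E')
    (ha2 : E' ≤ cyclicPos n j a ∨ (H' ≤ cyclicPos n j a ∧ cyclicPos n i a < H))
    (hc2 : E' ≤ cyclicPos n j c ∨ (H' ≤ cyclicPos n j c ∧ cyclicPos n i c < H))
    (hb2 : E ≤ cyclicPos n i b ∨ (H ≤ cyclicPos n i b ∧ cyclicPos n j b < H'))
    (hd2 : E ≤ cyclicPos n i d ∨ (H ≤ cyclicPos n i d ∧ cyclicPos n j d < H')) : False := by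
  have hia := cyclicPos_spec a hi.2
  have hib := cyclicPos_spec b hi.2
  have hic := cyclicPos_spec c hi.2
  have hid := cyclicPos_spec d hi.2
  have hja := cyclicPos_spec a hj.2
  have hjb := cyclicPos_spec b hj.2
  have hjc := cyclicPos_spec c hj.2
  have hjd := cyclicPos_spec d hj.2
  generalize cyclicPos n i a = ia at *
  generalize cyclicPos n i b = ib at *
  generalize cyclicPos n i c = ic at *
  generalize cyclicPos n i d = id at *
  generalize cyclicPos n j a = ja at *
  generalize cyclicPos n j b = jb at *
  generalize cyclicPos n j c = jc at *
  generalize cyclicPos n j d = jd at *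
  obtain ⟨hab, hbc, hcd⟩ := h
  have hI : i ≤ a ∨ (a < i ∧ i ≤ b) ∨ (b < i ∧ i ≤ c) ∨ (c < i ∧ i ≤ d) ∨ d < i := by omega
  have hJ : j ≤ a ∨ (a < j ∧ j ≤ b) ∨ (b < j ∧ j ≤ c) ∨ (c < j ∧ j ≤ d) ∨ d < j := by omega
  rcases hI with hI | hI | hI | hI | hI <;> rcases hJ with hJ | hJ | hJ | hJ | hJ <;>
  rcases ha2 with ha2 | ha2 <;> rcases hb2 with hb2 | hb2 <;>
  rcases hc2 with hc2 | hc2 <;> rcases hd2 with hd2 | hd2 <;> omega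

/-- `S` consists of the elements of `P` at cyclic distance less than `E` from `i`, where the
elements of `A` are required to be at distance less than `H` too. -/
def IsCutInterval (n : ℕ) (P A : ℕ → Prop) (S : Finset ℕ) : Prop :=
  ∃ i E H : ℕ, (1 ≤ i ∧ i ≤ n) ∧
    ∀ y, y ∈ S ↔ P y ∧ cyclicPos n i y < E ∧ (A y → cyclicPos n i y < H)

theorem IsCutInterval.weaklySeparated {n : ℕ} {P A : ℕ → Prop} {S T : Finset ℕ}
    (hP : ∀ y, P y → 1 ≤ y ∧ y ≤ n) (hS : IsCutInterval n P A S) (hT : IsCutInterval n P A T) :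
    WeaklySeparated S T := by
  have key : ∀ S T : Finset ℕ, IsCutInterval n P A S → IsCutInterval n P A T →
      ∀ a b c d : ℕ, a < b ∧ b < c ∧ c < d →
      a ∈ S \ T → c ∈ S \ T → b ∈ T \ S → d ∈ T \ S → False := by
    rintro S T ⟨i, E, H, hi, hS⟩ ⟨j, E', H', hj, hT⟩ a b c d h ha hc hb hd
    have aux : ∀ {i j E E' H H' y : ℕ}, (P y ∧ cyclicPos n i y < E ∧ (A y → cyclicPos n i y < H)) →
        ¬ (P y ∧ cyclicPos n j y < E' ∧ (A y → cyclicPos n j y < H')) →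
        E' ≤ cyclicPos n j y ∨ (H' ≤ cyclicPos n j y ∧ cyclicPos n i y < H) := by
      intro i j E E' H H' y h1 h2
      by_cases hE : cyclicPos n j y < E'
      · by_cases hA : A y
        · exact Or.inr ⟨not_lt.1 fun h3 => h2 ⟨h1.1, hE, fun _ => h3⟩, h1.2.2 hA⟩
        · exact absurd ⟨h1.1, hE, fun h => absurd h hA⟩ h2
      · exact Or.inl (not_lt.1 hE)
    simp only [Finset.mem_sdiff, hS, hT] at ha hb hc hd
    exact not_alternating_of_cyclicPos h hi hj (hP a ha.1.1).1 (hP d hd.1.1).2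
      ha.1.2.1 hc.1.2.1 hb.1.2.1 hd.1.2.1 (aux ha.1 ha.2) (aux hc.1 hc.2) (aux hb.1 hb.2)
      (aux hd.1 hd.2)
  rintro ⟨a, b, c, d, hab, hbc, hcd, ⟨ha, hc, hb, hd⟩ | ⟨ha, hc, hb, hd⟩⟩
  · exact key S T hS hT a b c d ⟨hab, hbc, hcd⟩ ha hc hb hd
  · exact key T S hT hS a b c d ⟨hab, hbc, hcd⟩ ha hc hb hd

theorem cyclicSucc_cases {P : Finset ℕ} (hP : P.Nonempty) (x : ℕ) :
    cyclicSucc P x ∈ P ∧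
      ((x < cyclicSucc P x ∧ ∀ y ∈ P, x < y → cyclicSucc P x ≤ y) ∨
       ((∀ y ∈ P, y ≤ x) ∧ ∀ y ∈ P, cyclicSucc P x ≤ y)) := by
  unfold cyclicSucc
  split_ifs with h
  · have h1 := Finset.min'_mem _ h
    rw [Finset.mem_filter] at h1
    exact ⟨h1.1, Or.inl ⟨h1.2, fun y hy hxy => Finset.min'_le _ _ (by simp [hy, hxy])⟩⟩
  · refine ⟨Finset.min'_mem _ _, Or.inr ⟨fun y hy => ?_, fun y hy => Finset.min'_le _ _ hy⟩⟩
    by_contra hxy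
    exact h ⟨y, by simp [hy, not_le.1 hxy]⟩

theorem cyclicPos_le_of_lt_cyclicSucc {n i y z : ℕ} {Q : Finset ℕ}
    (hQ : ∀ y ∈ Q, 1 ≤ y ∧ y ≤ n) (hi : i ∈ Q) (hy : y ∈ Q) (hz : z ∈ Q)
    (h : cyclicPos n i y < cyclicPos n i (cyclicSucc Q z)) :
    cyclicPos n i y ≤ cyclicPos n i z := by
  obtain ⟨hs, hc⟩ := cyclicSucc_cases ⟨i, hi⟩ z
  have h1 := cyclicPos_spec y (hQ i hi).2
  have h2 := cyclicPos_spec z (hQ i hi).2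
  have h3 := cyclicPos_spec (cyclicSucc Q z) (hQ i hi).2
  have := hQ _ hs
  have := hQ _ hy
  have := hQ _ hz
  have := hQ _ hi
  rcases hc with ⟨hc1, hc2⟩ | ⟨hc1, hc2⟩
  · have := hc2 y hy
    have := hc2 i hi
    omega
  · have := hc1 y hy
    have := hc1 i hi
    have := hc2 y hy
    have := hc2 i hi
    omega

theorem cyclicSucc_iterate_mem {Q : Finset ℕ} {i : ℕ} (hi : i ∈ Q) (j : ℕ) :
    (cyclicSucc Q)^[j] i ∈ Q := by
  induction j with
  | zero => exact hi
  | succ j _ =>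
    rw [Function.iterate_succ_apply']
    exact (cyclicSucc_cases ⟨i, hi⟩ _).1

theorem exists_iterate_eq_of_cyclicPos_lt {n i : ℕ} {Q : Finset ℕ}
    (hQ : ∀ y ∈ Q, 1 ≤ y ∧ y ≤ n) (hi : i ∈ Q) (j : ℕ) {y : ℕ} (hy : y ∈ Q)
    (h : cyclicPos n i y < cyclicPos n i ((cyclicSucc Q)^[j] i)) :
    ∃ t < j, (cyclicSucc Q)^[t] i = y := by
  induction j with
  | zero => simp [cyclicPos] at h
  | succ j ih =>
    rw [Function.iterate_succ_apply'] at h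
    have hz := cyclicSucc_iterate_mem hi j
    rcases (cyclicPos_le_of_lt_cyclicSucc hQ hi hy hz h).lt_or_eq with h1 | h1
    · obtain ⟨t, ht, rfl⟩ := ih h1
      exact ⟨t, by omega, rfl⟩
    · exact ⟨j, by omega, (cyclicPos_inj (hQ i hi).2 (hQ y hy) (hQ _ hz) h1).symm⟩

/-- Cyclically consecutive elements of `Q` starting from `i` are those at bounded distance. -/
theorem exists_mem_image_iterate_iff {n i : ℕ} {Q : Finset ℕ}
    (hQ : ∀ y ∈ Q, 1 ≤ y ∧ y ≤ n) (hi : i ∈ Q) (k : ℕ) :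
    ∃ E, ∀ y, y ∈ (Finset.range k).image (fun j => (cyclicSucc Q)^[j] i) ↔
      y ∈ Q ∧ cyclicPos n i y < E := by
  refine ⟨((Finset.range k).image (fun j => (cyclicSucc Q)^[j] i)).sup
    (fun y => cyclicPos n i y + 1), fun y => ⟨fun hy => ⟨?_, ?_⟩, ?_⟩⟩
  · obtain ⟨j, -, rfl⟩ := Finset.mem_image.1 hy
    exact cyclicSucc_iterate_mem hi j
  · exact Nat.lt_of_succ_le (Finset.le_sup (f := fun y => cyclicPos n i y + 1) hy)
  · rintro ⟨hy, h⟩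
    obtain ⟨z, hz, hyz⟩ := (Finset.lt_sup_iff).1 h
    obtain ⟨j, hj, rfl⟩ := Finset.mem_image.1 hz
    rw [Finset.mem_range] at hj
    rcases (Nat.lt_succ_iff.1 hyz).lt_or_eq with h1 | h1
    · obtain ⟨t, ht, rfl⟩ := exists_iterate_eq_of_cyclicPos_lt hQ hi j hy h1
      exact Finset.mem_image.2 ⟨t, Finset.mem_range.2 (by omega), rfl⟩
    · rw [cyclicPos_inj (hQ i hi).2 (hQ y hy) (hQ _ (cyclicSucc_iterate_mem hi j)) h1]
      exact hz

theorem mem_cyclicIntervalTo_cyclicSucc {P : Finset ℕ} {u v i : ℕ} (hu : u ∈ P) (hv : v ∈ P)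
    (h : i ∈ cyclicIntervalTo P (cyclicSucc P u) v) :
    i ∈ P ∧ (i ≤ v ∨ u < i) := by
  unfold cyclicIntervalTo at h
  split_ifs at h with hex
  · obtain ⟨j, hj, rfl⟩ := Finset.mem_image.1 h
    rw [Finset.mem_range] at hj
    have hs := (cyclicSucc_cases ⟨u, hu⟩ u).1
    refine ⟨cyclicSucc_iterate_mem hs j, ?_⟩
    clear h
    induction j with
    | zero =>
      rcases (cyclicSucc_cases ⟨u, hu⟩ u).2 with h1 | h1
      · exact Or.inr h1.1
      · exact Or.inl (h1.2 v hv)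
    | succ j ih =>
      have hne : (cyclicSucc P)^[j] (cyclicSucc P u) ≠ v := Nat.find_min hex (by omega)
      have ih := ih (by omega)
      simp only [Function.iterate_succ_apply']
      generalize (cyclicSucc P)^[j] (cyclicSucc P u) = z at *
      rcases (cyclicSucc_cases ⟨u, hu⟩ z).2 with h1 | h1
      · have := h1.1
        have := h1.2 v hv
        omega
      · exact Or.inl (h1.2 v hv)
  · simp at h

theorem mem_orbit_iff {d ℓ b y : ℕ} (hb : 1 ≤ b ∧ b ≤ ℓ) :
    y ∈ orbit d ℓ b ↔ (1 ≤ y ∧ y ≤ d * ℓ) ∧ y ≡ b [MOD ℓ] := by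
  unfold orbit
  simp only [Finset.mem_image, Finset.mem_range]
  constructor
  · rintro ⟨i, hi, rfl⟩
    have : (i + 1) * ℓ ≤ d * ℓ := Nat.mul_le_mul_right _ hi
    rw [add_mul] at this
    exact ⟨⟨by omega, by omega⟩, by simp [Nat.ModEq]⟩
  · rintro ⟨⟨h1, h2⟩, h⟩
    have hby : b ≤ y := by
      by_contra hlt
      have := (Nat.modEq_iff_dvd' (by omega)).1 h
      have := Nat.le_of_dvd (by omega) this
      omega
    obtain ⟨i, hi⟩ := (Nat.modEq_iff_dvd' hby).1 h.symm
    rw [mul_comm] at hi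
    refine ⟨i, ?_, by omega⟩
    by_contra hid
    have : d * ℓ ≤ i * ℓ := Nat.mul_le_mul_right _ (not_lt.1 hid)
    omega

theorem mem_Pset_iff {d ℓ s y : ℕ} {a : ℕ → ℕ} (ha : Set.MapsTo a (Set.Icc 1 ℓ) (Set.Icc 1 ℓ))
    (hs : s ≤ ℓ) : y ∈ Pset d ℓ a s ↔
      (1 ≤ y ∧ y ≤ d * ℓ) ∧ ∀ j ∈ Finset.Icc 1 (s - 1), ¬ y ≡ a j [MOD ℓ] := by
  unfold Pset
  simp only [Finset.mem_sdiff, Finset.mem_biUnion, Finset.mem_Icc, not_exists, not_and]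
  refine and_congr_right fun hy => forall₂_congr fun j hj => ?_
  rw [mem_orbit_iff (ha ⟨hj.1, by omega⟩)]
  simp [hy]

theorem shiftMod_cases {n t y : ℕ} (hy : 1 ≤ y ∧ y ≤ n) (ht : t ≤ n) :
    (y + t ≤ n ∧ shiftMod n t y = y + t) ∨ (n < y + t ∧ shiftMod n t y + n = y + t) := by
  unfold shiftMod
  by_cases h : y + t ≤ n
  · rw [Nat.mod_eq_of_lt (by omega)]
    omega
  · rw [Nat.mod_eq_sub_mod (by omega), Nat.mod_eq_of_lt (by omega)]
    omega

theorem cyclicPos_shiftMod {n t i y : ℕ} (hi : 1 ≤ i ∧ i ≤ n) (hy : 1 ≤ y ∧ y ≤ n) (ht : t ≤ n) :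
    cyclicPos n (shiftMod n t i) (shiftMod n t y) = cyclicPos n i y := by
  have h1 := shiftMod_cases hi ht
  have h2 := shiftMod_cases hy ht
  have h3 := cyclicPos_spec y hi.2
  have h4 := cyclicPos_spec (i := shiftMod n t i) (n := n) (shiftMod n t y) (by omega)
  omega

theorem shiftMod_modEq {n t ℓ y : ℕ} (hn : ℓ ∣ n) (htl : ℓ ∣ t) (hy : 1 ≤ y ∧ y ≤ n)
    (ht : t ≤ n) : shiftMod n t y ≡ y [MOD ℓ] := by
  have hyt : y + t ≡ y [MOD ℓ] := by
    simpa using (Nat.ModEq.refl y).add (Nat.modEq_zero_iff_dvd.2 htl)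
  rcases shiftMod_cases hy ht with h | h
  · rw [h.2]
    exact hyt
  · have : shiftMod n t y + n ≡ shiftMod n t y [MOD ℓ] := by
      simpa using (Nat.ModEq.refl (shiftMod n t y)).add (Nat.modEq_zero_iff_dvd.2 hn)
    rw [h.2] at this
    exact this.symm.trans hyt

theorem IsCutInterval.shiftSet {n t : ℕ} {P A : ℕ → Prop} {S : Finset ℕ}
    (hP : ∀ y, P y → 1 ≤ y ∧ y ≤ n) (ht : t ≤ n)
    (hPt : ∀ y, 1 ≤ y ∧ y ≤ n → (P (shiftMod n t y) ↔ P y))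
    (hAt : ∀ y, 1 ≤ y ∧ y ≤ n → (A (shiftMod n t y) ↔ A y))
    (hS : IsCutInterval n P A S) : IsCutInterval n P A (shiftSet n t S) := by
  obtain ⟨i, E, H, hi, hS⟩ := hS
  refine ⟨shiftMod n t i, E, H, by have := shiftMod_cases hi ht; omega, fun y => ?_⟩
  unfold _root_.shiftSet
  rw [Finset.mem_image]
  constructor
  · rintro ⟨z, hz, rfl⟩
    rw [hS] at hz
    have hzn := hP z hz.1
    rwa [hPt z hzn, hAt z hzn, cyclicPos_shiftMod hi hzn ht]
  · intro hy
    have hyn := hP y hy.1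
    obtain ⟨z, hzn, rfl⟩ : ∃ z, (1 ≤ z ∧ z ≤ n) ∧ shiftMod n t z = y := by
      by_cases h : t < y
      · refine ⟨y - t, by omega, ?_⟩
        have := shiftMod_cases (n := n) (t := t) (y := y - t) (by omega) ht
        omega
      · refine ⟨y + n - t, by omega, ?_⟩
        have := shiftMod_cases (n := n) (t := t) (y := y + n - t) (by omega) ht
        omega
    rw [hPt z hzn, hAt z hzn, cyclicPos_shiftMod hi hzn ht] at hy
    exact ⟨z, (hS z).2 hy, rfl⟩

theorem mem_Psh_iff {d ℓ s h i y : ℕ} {a : ℕ → ℕ} (hP : ∀ y ∈ Pset d ℓ a s, 1 ≤ y ∧ y ≤ d * ℓ)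
    (has : 1 ≤ a s ∧ a s ≤ ℓ) (hd : 1 ≤ d)
    (hin : 1 ≤ i ∧ i ≤ d * ℓ) (hi : i ≤ a s ∨ a s + (d - 1) * ℓ < i) :
    y ∈ Psh d ℓ a s h ↔
      y ∈ Pset d ℓ a s ∧ (y ≡ a s [MOD ℓ] → cyclicPos (d * ℓ) i y < h * ℓ) := by
  obtain ⟨d, rfl⟩ : ∃ e, d = e + 1 := ⟨d - 1, by omega⟩
  have hsh : ∀ j < d + 1, shiftMod ((d + 1) * ℓ) (j * ℓ) (a s) = a s + j * ℓ := by
    intro j hj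
    have h1 : (j + 1) * ℓ ≤ (d + 1) * ℓ := Nat.mul_le_mul_right _ hj
    rw [add_mul j] at h1
    have := shiftMod_cases (n := (d + 1) * ℓ) (t := j * ℓ) (y := a s) (by omega) (by omega)
    omega
  have hpos : ∀ j < d + 1, cyclicPos ((d + 1) * ℓ) i (a s + j * ℓ) < h * ℓ ↔ j < h := by
    intro j hj
    have h1 : j * ℓ ≤ d * ℓ := Nat.mul_le_mul_right _ (by omega)
    have h2 := cyclicPos_spec (a s + j * ℓ) hin.2
    have h3 : j * ℓ ≤ cyclicPos ((d + 1) * ℓ) i (a s + j * ℓ) ∧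
        cyclicPos ((d + 1) * ℓ) i (a s + j * ℓ) < (j + 1) * ℓ := by
      rw [add_mul j]
      rw [Nat.add_sub_cancel] at hi
      rw [add_mul] at h2 hin ⊢
      omega
    constructor
    · intro h4
      exact Nat.lt_of_mul_lt_mul_right (h3.1.trans_lt h4)
    · intro h4
      exact h3.2.trans_le (Nat.mul_le_mul_right _ h4)
  unfold Psh
  rw [Finset.mem_sdiff]
  refine and_congr_right fun hy => ?_
  simp only [Finset.mem_image, Finset.mem_Ico, not_exists, not_and]
  constructor
  · intro h1 h2
    have h3 := (mem_orbit_iff has).2 ⟨hP y hy, h2⟩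
    simp only [orbit, Finset.mem_image, Finset.mem_range] at h3
    obtain ⟨j, hj, rfl⟩ := h3
    rw [hpos j hj]
    by_contra hjh
    exact h1 j ⟨by omega, hj⟩ (hsh j hj)
  · rintro h1 j ⟨hj1, hj2⟩ rfl
    rw [hsh j hj2] at h1
    have := (hpos j hj2).1 (h1 (by simp [Nat.ModEq]))
    omega

theorem isCutInterval_of_mem_Lset {d ℓ k s : ℕ} {a : ℕ → ℕ}
    (ha : Set.BijOn a (Set.Icc 1 ℓ) (Set.Icc 1 ℓ)) (hd : 1 ≤ d) (hs1 : 1 ≤ s) (hs2 : s ≤ ℓ)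
    {S : Finset ℕ} (hS : S ∈ Lset d ℓ k a s) :
    IsCutInterval (d * ℓ) (· ∈ Pset d ℓ a s) (· ≡ a s [MOD ℓ]) S := by
  have hP : ∀ y ∈ Pset d ℓ a s, 1 ≤ y ∧ y ≤ d * ℓ :=
    fun y hy => ((mem_Pset_iff ha.mapsTo hs2).1 hy).1
  have has : 1 ≤ a s ∧ a s ≤ ℓ := ha.mapsTo ⟨hs1, hs2⟩
  have horb : ∀ y, (1 ≤ y ∧ y ≤ d * ℓ) → y ≡ a s [MOD ℓ] → y ∈ Pset d ℓ a s := by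
    refine fun y hy h => (mem_Pset_iff ha.mapsTo hs2).2 ⟨hy, fun j hj hyj => ?_⟩
    rw [Finset.mem_Icc] at hj
    have hj' : 1 ≤ a j ∧ a j ≤ ℓ := ha.mapsTo ⟨hj.1, by omega⟩
    have h1 : a s ∈ orbit 1 ℓ (a j) := (mem_orbit_iff hj').2 ⟨by omega, h.symm.trans hyj⟩
    simp only [orbit, Finset.range_one, Finset.image_singleton, zero_mul, add_zero,
      Finset.mem_singleton] at h1
    have := ha.injOn ⟨hs1, hs2⟩ (show j ∈ Set.Icc 1 ℓ from ⟨hj.1, by omega⟩) h1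
    omega
  simp only [Lset, Bset, Finset.mem_image, Finset.mem_product, Finset.mem_filter, Prod.exists] at hS
  obtain ⟨I, x, ⟨⟨⟨i, h, ⟨hi, hh⟩, rfl⟩, -⟩, hx⟩, rfl⟩ := hS
  rw [Finset.mem_Icc] at hh hx
  have hxt : x * ℓ ≤ d * ℓ := Nat.mul_le_mul_right _ hx.2
  have hmod : ∀ y, 1 ≤ y ∧ y ≤ d * ℓ → shiftMod (d * ℓ) (x * ℓ) y ≡ y [MOD ℓ] :=
    fun y hy => shiftMod_modEq (Dvd.intro_left _ rfl) (Dvd.intro_left _ rfl) hy hxt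
  refine IsCutInterval.shiftSet hP hxt (fun y hy => ?_) (fun y hy => ?_) ?_
  · rw [mem_Pset_iff ha.mapsTo hs2, mem_Pset_iff ha.mapsTo hs2]
    refine and_congr ?_ (forall₂_congr fun j _ => not_congr ?_)
    · have := shiftMod_cases hy hxt
      omega
    · exact ⟨(hmod y hy).symm.trans, (hmod y hy).trans⟩
  · exact ⟨(hmod y hy).symm.trans, (hmod y hy).trans⟩
  · have hdl : d * ℓ = (d - 1) * ℓ + ℓ := by
      rw [← Nat.succ_mul, Nat.succ_eq_add_one, Nat.sub_add_cancel hd]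
    have hlast : shiftMod (d * ℓ) (d * ℓ - ℓ) (a s) = a s + (d - 1) * ℓ := by
      have := shiftMod_cases (n := d * ℓ) (t := d * ℓ - ℓ) (y := a s) (by omega) (by omega)
      omega
    rw [hlast] at hi
    obtain ⟨hiP, hi⟩ := mem_cyclicIntervalTo_cyclicSucc
      (horb _ (by omega) (by simp [Nat.ModEq])) (horb _ (by omega) rfl) hi
    have hQ := fun y => mem_Psh_iff (h := h) (y := y) hP has hd (hP i hiP) hi
    have hiQ : i ∈ Psh d ℓ a s h := by
      rw [hQ]
      have : 0 < h * ℓ := Nat.mul_pos (by omega) (by omega)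
      simpa [cyclicPos, hiP] using fun _ => this
    obtain ⟨E, hE⟩ := exists_mem_image_iterate_iff
      (fun y hy => hP y ((hQ y).1 hy).1) hiQ k
    refine ⟨i, E, h * ℓ, hP i hiP, fun y => ?_⟩
    unfold Iih
    rw [hE, hQ]
    tauto

theorem card_le_of_mem_Lset {d ℓ k s : ℕ} {a : ℕ → ℕ} {S : Finset ℕ}
    (hS : S ∈ Lset d ℓ k a s) : S.card ≤ k := by
  simp only [Lset, Bset, Finset.mem_image, Finset.mem_filter, Prod.exists,
    Finset.mem_product] at hS
  obtain ⟨I, x, ⟨⟨-, hI⟩, -⟩, rfl⟩ := hS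
  exact Finset.card_image_le.trans hI.le

theorem weaklySeparated_of_card_le_one {S T : Finset ℕ} (hS : S.card ≤ 1) (hT : T.card ≤ 1) :
    WeaklySeparated S T := by
  rw [Finset.card_le_one] at hS hT
  rintro ⟨a, b, c, d, hab, hbc, -, ⟨ha, hc, -, -⟩ | ⟨ha, hc, -, -⟩⟩
  · have := hS a (Finset.mem_sdiff.1 ha).1 c (Finset.mem_sdiff.1 hc).1
    omega
  · have := hT a (Finset.mem_sdiff.1 ha).1 c (Finset.mem_sdiff.1 hc).1
    omega

/-- With the algorithm setup (`n = dℓ`, `k = dr + c`, `c ∈ {−1,0,1}`):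
for every `1 ≤ s ≤ ℓ − r + 1`, the collection `L_s` is weakly separated. -/
theorem stmt13 (d ℓ k : ℕ) (hd : 1 ≤ d) (hl : 1 ≤ ℓ) (hk1 : 1 ≤ k) (hk2 : 2 * k ≤ d * ℓ)
    (a : ℕ → ℕ) (ha : Set.BijOn a (Set.Icc 1 ℓ) (Set.Icc 1 ℓ))
    (r : ℕ) (c : ℤ) (hc : c = -1 ∨ c = 0 ∨ c = 1) (hk : (k : ℤ) = d * r + c)
    (s : ℕ) (hs1 : 1 ≤ s) (hs2 : s ≤ ℓ - r + 1) :
    ∀ I ∈ Lset d ℓ k a s, ∀ J ∈ Lset d ℓ k a s, WeaklySeparated I J := by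
  intro I hI J hJ
  by_cases hs : s ≤ ℓ
  · exact (isCutInterval_of_mem_Lset ha hd hs1 hs hI).weaklySeparated
      (fun y hy => ((mem_Pset_iff ha.mapsTo hs).1 hy).1) (isCutInterval_of_mem_Lset ha hd hs1 hs hJ)
  · have hr : r = 0 := by omega
    subst hr
    have hk' : k = 1 := by
      rw [Nat.cast_zero, mul_zero] at hk
      omega
    subst hk'
    exact weaklySeparated_of_card_le_one (card_le_of_mem_Lset hI) (card_le_of_mem_Lset hJ)
end
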